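/- Assume gcd(s+l,2l) = 2·gcd(s,l), and write d = gcd(s,l). Let i = p^{s+2d−1}(p−1)(p^{s−2d} + 1) and λ = p^{s−2d−1}·(p^{s−d} − 1)·(p^{s−2d} + 1)·[p^{s+2d−1}(p−1)(p^{s−2d} + 1) − 1]/((p^d + 1)(p^{2d} − 1)). Then the distinct supports of the codewords of Hamming weight i in C form a 2-(p^m, i, λ) design on the point set F_q: each such support has exactly i elements, and every 2-element subset of F_q is contained in exactly λ of the distinct supports. -/

import Mathlib

/-- `trp p r z = z + z^p + ⋯ + z^(p^(r-1))`, the trace form used for `Tr_r`. -/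
def trp (p r : ℕ) {F : Type} [Field F] (z : F) : F :=
  ∑ i ∈ Finset.range r, z ^ p ^ i

/-- The codeword `c(a,b,c,h)` of the code `C`, viewed as a function on `F_q = F`;
its value at `x` is `Tr_s(a x^(p^s+1)) + Tr_m(b x^(p^l+1) + c x) + h` (the values
lie in the prime field `F_p ⊆ F`). Here `m = 2s`. -/
def cword (p s l : ℕ) {F : Type} [Field F] (a b c : F) (h : ZMod p) : F → F :=
  fun x => trp p s (a * x ^ (p ^ s + 1)) + trp p (2 * s) (b * x ^ (p ^ l + 1) + c * x)
    + ZMod.cast h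

/-- The support of the codeword `c(a,b,c,h)`; its cardinality is the Hamming weight. -/
def suppw (p s l : ℕ) {F : Type} [Field F] [Fintype F] [DecidableEq F]
    (a b c : F) (h : ZMod p) : Finset F :=
  Finset.univ.filter fun x => cword p s l a b c h x ≠ 0

theorem card_fiber_of_shift {p : ℕ} [Fact p.Prime] {V : Type*} [AddCommGroup V] [Fintype V]
    (g : V → ZMod p) (z : V) {e : ZMod p} (he : e ≠ 0) (h : ∀ x, g (x + z) = g x + e)
    (v : ZMod p) : p * (Finset.univ.filter fun x => g x = v).card = Fintype.card V := by
  have step : ∀ v, (Finset.univ.filter fun x => g x = v + e).card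
      = (Finset.univ.filter fun x => g x = v).card := by
    intro v
    symm
    refine Finset.card_bij (fun x _ => x + z) ?_ ?_ ?_
    · intro x hx
      simp only [Finset.mem_filter, Finset.mem_univ, true_and] at hx ⊢
      rw [h, hx]
    · intro x _ y _ hxy
      exact add_right_cancel hxy
    · intro y hy
      refine ⟨y - z, ?_, by simp⟩
      simp only [Finset.mem_filter, Finset.mem_univ, true_and] at hy ⊢
      have := h (y - z)
      rw [sub_add_cancel, hy] at this
      exact (add_right_cancel this).symm
  have steps : ∀ n : ℕ, (Finset.univ.filter fun x => g x = v + n * e).card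
      = (Finset.univ.filter fun x => g x = v).card := by
    intro n
    induction n with
    | zero => simp
    | succ n ih =>
      rw [← ih, ← step (v + n * e)]
      push_cast
      rw [add_mul, one_mul, add_assoc]
  have all : ∀ w, (Finset.univ.filter fun x => g x = w).card
      = (Finset.univ.filter fun x => g x = v).card := by
    intro w
    rw [← steps ((w - v) / e).val, ZMod.natCast_zmod_val, div_mul_cancel₀ _ he, add_sub_cancel]
  have := Finset.card_eq_sum_card_fiberwise (f := g) (s := (Finset.univ : Finset V))
    (t := Finset.univ) (by intro x _; simp)
  rw [Finset.sum_congr rfl (fun w _ => all w)] at this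
  simpa [ZMod.card] using this.symm

theorem card_fiber_of_hom {p : ℕ} [Fact p.Prime] {V : Type*} [AddCommGroup V] [Fintype V]
    (g : V →+ ZMod p) {z : V} (hz : g z ≠ 0) (v : ZMod p) :
    p * (Finset.univ.filter fun x => g x = v).card = Fintype.card V :=
  card_fiber_of_shift g z hz (fun x => map_add g x z) v

theorem quad_fiber_zero {p : ℕ} [Fact p.Prime] {V : Type*} [Fintype V]
    (Q : V → ZMod p) {M : ℕ} (hM : ∀ v, v ≠ 0 → (Finset.univ.filter fun x => Q x = v).card = M) :
    ((Finset.univ.filter fun x => Q x = 0).card : ℤ) = Fintype.card V - (p - 1) * M := by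
  have := Finset.card_eq_sum_card_fiberwise (f := Q) (s := (Finset.univ : Finset V))
    (t := Finset.univ) (by intro x _; simp)
  rw [← Finset.add_sum_erase _ _ (Finset.mem_univ (0 : ZMod p)),
    Finset.sum_congr rfl (fun w hw => hM w (Finset.ne_of_mem_erase hw))] at this
  have hp : 1 ≤ p := (Fact.out : p.Prime).one_le
  simp only [Finset.card_univ, Finset.sum_const, Finset.card_erase_of_mem (Finset.mem_univ _),
    ZMod.card, smul_eq_mul] at this
  rw [this]
  push_cast [Nat.cast_sub hp]
  ring

theorem quad_sq {p : ℕ} [Fact p.Prime] {V : Type*} [AddCommGroup V] [Fintype V]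
    (Q : V → ZMod p) (B : V → V →+ ZMod p) (hB : ∀ x z, Q (x + z) = Q x + Q z + B z x)
    (hrad : ∀ z, B z = 0 → Q z = 0) {M : ℕ}
    (hM : ∀ v, v ≠ 0 → (Finset.univ.filter fun x => Q x = v).card = M) [DecidablePred fun z => B z = 0] :
    ((Fintype.card V : ℤ) - p * M) ^ 2
      = Fintype.card V * (Finset.univ.filter fun z => B z = 0).card := by
  classical
  set q : ℤ := (Fintype.card V : ℤ) with hq
  have hp : 1 ≤ p := (Fact.out : p.Prime).one_le
  have h0 := quad_fiber_zero Q hM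
  -- the number of pairs with equal value, counted in two ways
  have e1 : ((Finset.univ.filter fun t : V × V => Q (t.1 + t.2) = Q t.1).card : ℤ)
      = ∑ v : ZMod p, ((Finset.univ.filter fun x => Q x = v).card : ℤ) ^ 2 := by
    rw [Finset.card_eq_sum_card_fiberwise (f := fun t : V × V => Q t.1)
      (t := Finset.univ) (by intro x _; simp)]
    push_cast
    refine Finset.sum_congr rfl fun v _ => ?_
    rw [sq, ← Nat.cast_mul, ← Finset.card_product]
    congr 1
    refine Finset.card_bij (fun t _ => (t.1, t.1 + t.2)) ?_ ?_ ?_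
    · rintro ⟨x, y⟩ hx
      simp only [Finset.mem_filter, Finset.mem_univ, true_and, Finset.mem_product] at hx ⊢
      exact ⟨hx.2, hx.1.trans hx.2⟩
    · rintro ⟨x, y⟩ _ ⟨x', y'⟩ _ h
      simp only [Prod.mk.injEq] at h
      obtain ⟨rfl, h⟩ := h
      simpa using h
    · rintro ⟨x, y⟩ h
      simp only [Finset.mem_filter, Finset.mem_univ, true_and, Finset.mem_product] at h
      refine ⟨(x, y - x), ?_, by simp⟩
      simp [h.1, h.2]
  have e2 : ((p * (Finset.univ.filter fun t : V × V => Q (t.1 + t.2) = Q t.1).card : ℕ) : ℤ)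
      = ∑ z : V, (q + if B z = 0 then (p - 1) * q else 0) := by
    rw [Finset.card_eq_sum_card_fiberwise (f := fun t : V × V => t.2)
      (t := Finset.univ) (by intro x _; simp)]
    rw [Finset.mul_sum]
    push_cast
    refine Finset.sum_congr rfl fun z _ => ?_
    have : ((Finset.univ.filter fun t : V × V => Q (t.1 + t.2) = Q t.1).filter
        fun t => t.2 = z).card = (Finset.univ.filter fun x => B z x = - Q z).card := by
      refine Finset.card_bij (fun t _ => t.1) ?_ ?_ ?_
      · rintro ⟨x, y⟩ hx
        simp only [Finset.mem_filter, Finset.mem_univ, true_and] at hx ⊢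
        obtain ⟨h, rfl⟩ := hx
        rw [hB] at h
        linear_combination h
      · rintro ⟨x, y⟩ hx ⟨x', y'⟩ hx' h
        simp only [Finset.mem_filter] at hx hx'
        simp [hx.2, hx'.2, show x = x' from h]
      · intro x hx
        simp only [Finset.mem_filter, Finset.mem_univ, true_and] at hx
        refine ⟨(x, z), ?_, rfl⟩
        simp only [Finset.mem_filter, Finset.mem_univ, true_and]
        rw [hB, hx]
        simp
    rw [this]
    split_ifs with hz
    · rw [hz, hrad z hz]
      simp
      ring
    · obtain ⟨y, hy⟩ : ∃ y, B z y ≠ 0 := by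
        by_contra! hc
        exact hz (AddMonoidHom.ext hc)
      rw [← Nat.cast_mul, card_fiber_of_hom (B z) hy, add_zero]
  rw [Finset.sum_add_distrib, ← Finset.sum_filter] at e2
  push_cast at e2
  rw [e1, ← Finset.add_sum_erase _ _ (Finset.mem_univ (0 : ZMod p)),
    Finset.sum_congr rfl (fun w hw => by rw [hM w (Finset.ne_of_mem_erase hw)]), h0] at e2
  simp only [Finset.card_univ, Finset.sum_const, Finset.card_erase_of_mem (Finset.mem_univ _),
    ZMod.card, nsmul_eq_mul, ← hq] at e2
  push_cast [Nat.cast_sub hp] at e2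
  have hp1 : (p : ℤ) - 1 ≠ 0 := by
    have := (Fact.out : p.Prime).two_le
    omega
  apply mul_left_cancel₀ hp1
  linear_combination e2

section Cyclic

variable {F : Type*} [Field F] [Fintype F] [DecidableEq F]

theorem exists_pow_eq_of_dvd {k : ℕ} (hk : k ∣ Fintype.card F - 1) {y : F} (hy : y ≠ 0)
    (h : y ^ ((Fintype.card F - 1) / k) = 1) : ∃ u : F, u ^ k = y := by
  obtain ⟨n, hn⟩ := hk
  have hpos : 0 < Fintype.card F - 1 := by have := Fintype.one_lt_card (α := F); omega
  have hk0 : 0 < k := Nat.pos_of_ne_zero (by rintro rfl; simp at hn; omega)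
  obtain ⟨g, hg⟩ := IsCyclic.exists_generator (α := Fˣ)
  obtain ⟨j, hj⟩ := (Submonoid.mem_powers_iff _ _).1
    (mem_powers_iff_mem_zpowers.2 (hg (Units.mk0 y hy)))
  have hord : orderOf g = k * n := by
    rw [orderOf_eq_card_of_forall_mem_zpowers hg, Nat.card_eq_fintype_card, Fintype.card_units, hn]
  have h1 : g ^ (j * n) = 1 := by
    rw [pow_mul, hj]
    ext
    rw [hn, Nat.mul_div_cancel_left _ hk0] at h
    simpa using h
  have h2 := orderOf_dvd_of_pow_eq_one h1
  rw [hord] at h2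
  have hn0 : 0 < n := Nat.pos_of_ne_zero (by rintro rfl; simp at hn; omega)
  obtain ⟨i, rfl⟩ := Nat.dvd_of_mul_dvd_mul_right hn0 h2
  refine ⟨((g ^ i : Fˣ) : F), ?_⟩
  rw [← Units.val_pow_eq_pow_val, ← pow_mul, mul_comm i k, hj]
  rfl

theorem card_pow_eq_pow {k : ℕ} (hk : k ∣ Fintype.card F - 1) {y : F} (hy : y ≠ 0) :
    (Finset.univ.filter fun x : F => x ^ k = y ^ k).card = k := by
  have hpos : 0 < Fintype.card F - 1 := by have := Fintype.one_lt_card (α := F); omega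
  have hk0 : k ≠ 0 := by rintro rfl; simp at hk; omega
  have := IsCyclic.card_powMonoidHom_ker (G := Fˣ) k
  rw [Nat.card_eq_fintype_card (α := Fˣ), Fintype.card_units, Nat.gcd_eq_right hk] at this
  refine Eq.trans ?_ this
  rw [Nat.card_eq_fintype_card, ← Fintype.card_coe]
  have key : ∀ u : (powMonoidHom k : Fˣ →* Fˣ).ker, y * ((u : Fˣ) : F) ∈
      Finset.univ.filter fun x : F => x ^ k = y ^ k := by
    intro u
    have := u.2
    rw [MonoidHom.mem_ker, powMonoidHom_apply] at this
    have h := congrArg Units.val this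
    simp only [Units.val_pow_eq_pow_val, Units.val_one] at h
    rw [Finset.mem_filter, mul_pow, h, mul_one]
    exact ⟨Finset.mem_univ _, rfl⟩
  refine (Fintype.card_congr (Equiv.ofBijective (fun u => ⟨_, key u⟩) ⟨?_, ?_⟩)).symm
  · intro u v h
    exact Subtype.ext (Units.ext (mul_left_cancel₀ hy (congrArg Subtype.val h)))
  · rintro ⟨x, hx⟩
    simp only [Finset.mem_filter, Finset.mem_univ, true_and] at hx
    have hx0 : x ≠ 0 := by
      rintro rfl
      rw [zero_pow hk0] at hx
      exact hy (pow_eq_zero_iff hk0 |>.1 hx.symm)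
    refine ⟨⟨Units.mk0 (x / y) (div_ne_zero hx0 hy), ?_⟩, ?_⟩
    · rw [MonoidHom.mem_ker, powMonoidHom_apply]
      ext
      simp [div_pow, hx, hy]
    · simp [mul_div_cancel₀ _ hy]

theorem dvd_card_filter_of_pow {k : ℕ} (hk : k ∣ Fintype.card F - 1) (P : F → Prop)
    [DecidablePred P] (h0 : ¬ P 0) (h : ∀ x y, x ^ k = y ^ k → P x → P y) :
    k ∣ (Finset.univ.filter P).card := by
  rw [Finset.card_eq_sum_card_image (fun x : F => x ^ k)]
  refine Finset.dvd_sum fun z hz => ?_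
  obtain ⟨y, hy, rfl⟩ := Finset.mem_image.1 hz
  simp only [Finset.mem_filter, Finset.mem_univ, true_and] at hy
  rw [Finset.filter_filter]
  have hy0 : y ≠ 0 := by rintro rfl; exact h0 hy
  refine dvd_of_eq ((card_pow_eq_pow hk hy0).symm.trans (congrArg Finset.card ?_))
  ext x
  simp only [Finset.mem_filter, Finset.mem_univ, true_and]
  exact ⟨fun hx => ⟨h y x hx.symm hy, hx⟩, fun hx => hx.2⟩

end Cyclic

section Trace

variable (p : ℕ) [Fact p.Prime] {F : Type} [Field F] [CharP F p]

/-- The absolute trace of a field of characteristic `p`, with values in `ZMod p`. -/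
noncomputable def absTr : F →+ ZMod p :=
  letI := ZMod.algebra F p
  (Algebra.trace (ZMod p) F).toAddMonoidHom

variable {p}

theorem cast_absTr [Fintype F] {m : ℕ} (hF : Fintype.card F = p ^ m) (x : F) :
    (ZMod.cast (absTr p x) : F) = trp p m x := by
  let _ := ZMod.algebra F p
  have h := FiniteField.algebraMap_trace_eq_sum_pow (ZMod p) F x
  have hm : Module.finrank (ZMod p) F = m := by
    have := Module.card_eq_pow_finrank (K := ZMod p) (V := F)
    rw [hF, ZMod.card] at this
    exact (Nat.pow_right_injective (Fact.out : p.Prime).two_le this).symm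
  rw [hm, Nat.card_eq_fintype_card, ZMod.card] at h
  exact h

theorem absTr_eq_zero_of_forall [Finite F] {x : F} (h : ∀ y, absTr p (x * y) = 0) : x = 0 := by
  let _ := ZMod.algebra F p
  exact (traceForm_nondegenerate (ZMod p) F).1 x h

theorem absTr_pow [Finite F] (x : F) (n : ℕ) : absTr p (x ^ p ^ n) = absTr p x := by
  let _ := ZMod.algebra F p
  have h1 : ∀ x : F, absTr p (x ^ p) = absTr p x := fun x => by
    have := Algebra.trace_eq_of_algEquiv (FiniteField.frobeniusAlgEquivOfAlgebraic (ZMod p) F) x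
    rwa [FiniteField.coe_frobeniusAlgEquivOfAlgebraic, ZMod.card] at this
  induction n with
  | zero => simp
  | succ n ih => rw [pow_succ, pow_mul, h1, ih]

theorem exists_absTr_ne_zero_of_notMem_range [Finite F] (L : F →+ F)
    (hL : ∀ x y, absTr p (L x * y) = absTr p (L y * x)) {c : F} (hc : ∀ x, L x ≠ c) :
    ∃ z, L z = 0 ∧ absTr p (c * z) ≠ 0 := by
  let _ := ZMod.algebra F p
  by_contra! hcon
  have hnd : (Algebra.traceForm (ZMod p) F).Nondegenerate := traceForm_nondegenerate _ _
  have hrefl : (Algebra.traceForm (ZMod p) F).IsRefl := (Algebra.traceForm_isSymm _).isRefl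
  have := LinearMap.BilinForm.orthogonal_orthogonal hnd hrefl
    (LinearMap.range (L.toZModLinearMap p))
  have hmem : c ∈ (Algebra.traceForm (ZMod p) F).orthogonal
      ((Algebra.traceForm (ZMod p) F).orthogonal (LinearMap.range (L.toZModLinearMap p))) := by
    rw [LinearMap.BilinForm.mem_orthogonal_iff]
    intro z hz
    rw [LinearMap.BilinForm.mem_orthogonal_iff] at hz
    have hz0 : L z = 0 := by
      refine absTr_eq_zero_of_forall (p := p) fun y => ?_
      rw [hL]
      exact hz (L y) ⟨y, rfl⟩
    have := hcon z hz0
    rw [mul_comm] at this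
    exact this
  rw [this] at hmem
  obtain ⟨x, hx⟩ := hmem
  exact hc x hx

end Trace

section Frobenius

variable {p : ℕ} [Fact p.Prime] {F : Type} [Field F] [CharP F p]

theorem pow_pow_iterate (x : F) (m n : ℕ) : (x ^ p ^ m) ^ p ^ n = x ^ p ^ (m + n) := by
  rw [← pow_mul, pow_add]

theorem pow_char_pow_injective (n : ℕ) : Function.Injective fun x : F => x ^ p ^ n :=
  (iterateFrobenius F p n).injective

theorem pow_eq_self_mul {x : F} {m : ℕ} (h : x ^ p ^ m = x) (n : ℕ) : x ^ p ^ (m * n) = x := by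
  induction n with
  | zero => simp
  | succ n ih => rw [Nat.mul_succ, ← pow_pow_iterate, ih, h]

theorem pow_eq_self_gcd {x : F} {m n : ℕ} (hm : x ^ p ^ m = x) (hn : x ^ p ^ n = x) :
    x ^ p ^ Nat.gcd m n = x := by
  simp only [← iterate_frobenius] at *
  exact Function.IsPeriodicPt.gcd hm hn

theorem pow_card_self [Fintype F] {m : ℕ} (hF : Fintype.card F = p ^ m) (x : F) :
    x ^ p ^ m = x := by
  rw [← hF, FiniteField.pow_card]

/-- If `x ^ p ^ d = -x`, then the same holds for odd multiples of `d`. -/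
theorem pow_eq_neg_odd_mul {x : F} {d : ℕ} (hp : Odd p) (h : x ^ p ^ d = -x) (k : ℕ) :
    x ^ p ^ (d * (2 * k + 1)) = -x := by
  have h2 : x ^ p ^ (2 * d) = x := by
    rw [two_mul, ← pow_pow_iterate, h, (hp.pow).neg_pow, h, neg_neg]
  rw [show d * (2 * k + 1) = 2 * d * k + d by ring, ← pow_pow_iterate, pow_eq_self_mul h2, h]

theorem pow_odd_mul_of_pow_two {x : F} {d : ℕ} (h : x ^ p ^ (2 * d) = x) (k : ℕ) :
    x ^ p ^ (d * (2 * k + 1)) = x ^ p ^ d := by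
  rw [show d * (2 * k + 1) = 2 * d * k + d by ring, ← pow_pow_iterate, pow_eq_self_mul h]

theorem pow_sub_one_dvd_card [Fintype F] {m n : ℕ} (hF : Fintype.card F = p ^ m) (h : n ∣ m) :
    p ^ n - 1 ∣ Fintype.card F - 1 := by
  rw [hF]
  exact Nat.pow_sub_one_dvd_pow_sub_one p h

theorem card_pow_succ_eq_mul [Fintype F] [DecidableEq F] {k : ℕ} (hk : k ∣ Fintype.card F - 1)
    {y : F} (hy : y ≠ 0) :
    (Finset.univ.filter fun x : F => x ^ (k + 1) = y ^ k * x).card = k + 1 := by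
  have hk0 : k ≠ 0 := by
    rintro rfl
    have := Fintype.one_lt_card (α := F)
    rw [zero_dvd_iff] at hk
    omega
  have : (Finset.univ.filter fun x : F => x ^ (k + 1) = y ^ k * x)
      = insert 0 (Finset.univ.filter fun x : F => x ^ k = y ^ k) := by
    ext x
    by_cases hx : x = 0
    · simp [hx]
    · simp [hx, pow_succ]
  rw [this, Finset.card_insert_of_notMem (by simp [hk0, hy, eq_comm]), card_pow_eq_pow hk hy]

theorem card_pow_eq_self [Fintype F] [DecidableEq F] {m n : ℕ} (hF : Fintype.card F = p ^ m)
    (h : n ∣ m) : (Finset.univ.filter fun x : F => x ^ p ^ n = x).card = p ^ n := by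
  have h1 := card_pow_succ_eq_mul (pow_sub_one_dvd_card hF h) (one_ne_zero (α := F))
  rw [Nat.sub_add_cancel (Nat.one_le_pow _ _ (Fact.out : p.Prime).pos)] at h1
  simpa using h1

theorem card_pow_eq_neg [Fintype F] [DecidableEq F] {m n : ℕ} (hp : Odd p)
    (hF : Fintype.card F = p ^ m) (h : 2 * n ∣ m) :
    (Finset.univ.filter fun x : F => x ^ p ^ n = -x).card = p ^ n := by
  have hpos : 1 ≤ p ^ n := Nat.one_le_pow _ _ (Fact.out : p.Prime).pos
  have hd : p ^ n - 1 ∣ Fintype.card F - 1 := pow_sub_one_dvd_card hF (dvd_of_mul_left_dvd h)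
  obtain ⟨c, hc⟩ := pow_sub_one_dvd_card hF h
  have hcard := Fintype.one_lt_card (α := F)
  obtain ⟨r, hr⟩ : ∃ r, p ^ n = 2 * r + 1 := hp.pow
  have hr0 : r ≠ 0 := by
    rintro rfl
    rw [hr] at hd
    simp at hd
    omega
  have hc' : Fintype.card F - 1 = (p ^ n - 1) * (2 * ((r + 1) * c)) := by
    rw [hc, two_mul n, pow_add, hr]
    have : (2 * r + 1) * (2 * r + 1) - 1 = 2 * r * (2 * (r + 1)) := by
      rw [Nat.sub_eq_iff_eq_add (by nlinarith)]
      ring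
    rw [this]
    simp
    ring
  obtain ⟨y, hy⟩ := exists_pow_eq_of_dvd (y := (-1 : F)) hd (by simp) (by
    rw [hc', Nat.mul_div_cancel_left _ (by omega), pow_mul]
    simp)
  have hy0 : y ≠ 0 := by
    rintro rfl
    rw [zero_pow (by omega)] at hy
    simp at hy
  have h1 := card_pow_succ_eq_mul hd hy0
  rw [Nat.sub_add_cancel hpos, hy] at h1
  simpa using h1

end Frobenius

/-- The standing numerical hypotheses: `p` is odd, `F` has `p ^ (2 * s)` elements, `s` and `l` are
odd multiples of `d = gcd(s, l)` with `s ≠ d`, and `gcd(s + l, 2 * s) = 2 * d`. -/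
structure KasamiParams (p s l d : ℕ) (F : Type) [Fintype F] : Prop where
  odd : Odd p
  card : Fintype.card F = p ^ (2 * s)
  d_pos : 0 < d
  s_eq : ∃ k, 1 ≤ k ∧ s = d * (2 * k + 1)
  l_eq : ∃ j, l = d * (2 * j + 1)
  gcd_eq : Nat.gcd (s + l) (2 * s) = 2 * d
  l_le : l ≤ 2 * s

section Form

variable (p s l : ℕ) [Fact p.Prime] {F : Type} [Field F] [CharP F p]

/-- The quadratic form `x ↦ Tr_s(a x^(p^s+1)) + Tr_m(b x^(p^l+1))`. -/
noncomputable def qf (a b x : F) : ZMod p :=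
  absTr p (a / 2 * x ^ (p ^ s + 1) + b * x ^ (p ^ l + 1))

/-- The additive map representing the polar form of `qf` with respect to the trace form. -/
def adj (a b : F) : F →+ F :=
  AddMonoidHom.mk' (fun x => a * x ^ p ^ s + b * x ^ p ^ l + (b * x) ^ p ^ (2 * s - l)) (by
    intro x y
    simp only [mul_add, add_pow_char_pow]
    ring)

variable {p s l} {d : ℕ}

theorem adj_apply (a b x : F) :
    adj p s l a b x = a * x ^ p ^ s + b * x ^ p ^ l + (b * x) ^ p ^ (2 * s - l) := rfl

theorem natCast_pow_char_pow (n m : ℕ) : (n : F) ^ p ^ m = n := by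
  rw [← iterateFrobenius_def, map_natCast]

theorem absTr_natCast_mul (n : ℕ) (x : F) : absTr p ((n : F) * x) = n * absTr p x := by
  rw [← nsmul_eq_mul, map_nsmul, nsmul_eq_mul]

variable [Fintype F]

namespace KasamiParams

theorem two_ne_zero (H : KasamiParams p s l d F) : (2 : F) ≠ 0 := by
  have h2 : p ≠ 2 := by rintro rfl; exact absurd H.odd (by decide)
  exact Ring.two_ne_zero (by rwa [ringChar.eq F p])

theorem qf_add (H : KasamiParams p s l d F) {a : F} (ha : a ^ p ^ s = a) (b x z : F) :
    qf p s l a b (x + z) = qf p s l a b x + qf p s l a b z + absTr p (adj p s l a b z * x) := by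
  have h2 := H.two_ne_zero
  have e1 : absTr p (a / 2 * (z ^ p ^ s * x)) = absTr p (a / 2 * (x ^ p ^ s * z)) := by
    rw [← absTr_pow (a / 2 * (z ^ p ^ s * x)) s, mul_pow, mul_pow, div_pow, ha,
      pow_pow_iterate, ← two_mul, pow_card_self H.card]
    have : (2 : F) ^ p ^ s = 2 := by exact_mod_cast natCast_pow_char_pow (p := p) (F := F) 2 s
    rw [this, mul_comm z]
  have e2 : absTr p ((b * z) ^ p ^ (2 * s - l) * x) = absTr p (b * (x ^ p ^ l * z)) := by
    rw [← absTr_pow ((b * z) ^ p ^ (2 * s - l) * x) l, mul_pow, pow_pow_iterate,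
      Nat.sub_add_cancel H.l_le, pow_card_self H.card]
    ring_nf
  have e3 : a * z ^ p ^ s * x = a / 2 * (z ^ p ^ s * x) + a / 2 * (z ^ p ^ s * x) := by
    field_simp
    ring
  simp only [qf, adj_apply, add_mul, map_add]
  rw [e2, e3, map_add]
  nth_rewrite 2 [e1]
  simp only [← map_add]
  congr 1
  simp only [pow_succ, add_pow_char_pow]
  ring

theorem adj_symm (H : KasamiParams p s l d F) {a : F} (ha : a ^ p ^ s = a) (b x z : F) :
    absTr p (adj p s l a b x * z) = absTr p (adj p s l a b z * x) := by
  have h1 := H.qf_add ha b x z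
  have h2 := H.qf_add ha b z x
  rw [add_comm z x] at h2
  linear_combination h1 - h2

theorem qf_zero : qf p s l (0 : F) 0 = fun _ => (0 : ZMod p) := by
  ext x
  simp [qf]

theorem qf_map_zero (a b : F) : qf p s l a b 0 = 0 := by
  simp [qf]

theorem qf_neg (H : KasamiParams p s l d F) (a b x : F) :
    qf p s l a b (-x) = qf p s l a b x := by
  have h : ∀ n, Even (p ^ n + 1) := fun n => (H.odd.pow).add_one
  simp only [qf, (h _).neg_pow]

theorem qf_eq_zero_of_adj (H : KasamiParams p s l d F) {a : F} (ha : a ^ p ^ s = a) {b z : F}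
    (hz : adj p s l a b z = 0) : qf p s l a b z = 0 := by
  have h := H.qf_add ha b (-z) z
  rw [hz, neg_add_cancel, qf_map_zero, H.qf_neg] at h
  have h2 : (2 : ZMod p) ≠ 0 := by
    have h2 : p ≠ 2 := by rintro rfl; exact absurd H.odd (by decide)
    exact Ring.two_ne_zero (by rwa [ringChar.eq (ZMod p) p])
  have h3 : 2 * qf p s l a b z = 0 := by
    simp at h
    linear_combination -h
  exact (mul_eq_zero.1 h3).resolve_left h2

theorem two_d_dvd (H : KasamiParams p s l d F) : 2 * d ∣ 2 * s := by
  obtain ⟨k, -, rfl⟩ := H.s_eq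
  exact ⟨2 * k + 1, by ring⟩

theorem pow_two_d_of_pow_add (H : KasamiParams p s l d F) {x : F} (h : x ^ p ^ (s + l) = x) :
    x ^ p ^ (2 * d) = x := by
  rw [← H.gcd_eq]
  exact pow_eq_self_gcd h (pow_card_self H.card x)

theorem pow_add_of_pow_two_d (H : KasamiParams p s l d F) {x : F} (h : x ^ p ^ (2 * d) = x) :
    x ^ p ^ (s + l) = x := by
  obtain ⟨c, hc⟩ : 2 * d ∣ s + l := H.gcd_eq ▸ Nat.gcd_dvd_left _ _
  rw [hc]
  exact pow_eq_self_mul h c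

theorem adj_eq_zero_iff (H : KasamiParams p s l d F) (a b x : F) :
    adj p s l a b x = 0 ↔
      b * x + a ^ p ^ l * x ^ p ^ (s + l) + b ^ p ^ l * (x ^ p ^ (s + l)) ^ p ^ (s + l) = 0 := by
  have h0 : (0 : F) ^ p ^ l = 0 := zero_pow (pow_pos (Fact.out : p.Prime).pos _).ne'
  have e : (x ^ p ^ (s + l)) ^ p ^ (s + l) = (x ^ p ^ l) ^ p ^ l := by
    rw [pow_pow_iterate, pow_pow_iterate, show s + l + (s + l) = 2 * s + (l + l) by ring,
      ← pow_pow_iterate, pow_card_self H.card]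
  rw [← (pow_char_pow_injective (p := p) l).eq_iff, adj_apply]
  simp only [h0, add_pow_char_pow]
  rw [mul_pow, mul_pow, pow_pow_iterate _ (2 * s - l), pow_pow_iterate x s,
    Nat.sub_add_cancel H.l_le, pow_card_self H.card, e]
  rw [add_comm, add_assoc]

theorem adj_mul (H : KasamiParams p s l d F) {a b x y : F} (hx : adj p s l a b x = 0)
    (hy : y ^ p ^ (2 * d) = y) : adj p s l a b (y * x) = 0 := by
  rw [H.adj_eq_zero_iff] at hx ⊢
  simp only [mul_pow, H.pow_add_of_pow_two_d hy]
  linear_combination y * hx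

theorem card_radical_le [DecidableEq F] (H : KasamiParams p s l d F) {a b : F}
    (hab : a ≠ 0 ∨ b ≠ 0) :
    (Finset.univ.filter fun x => adj p s l a b x = 0).card ≤ p ^ (2 * d) * p ^ (2 * d) := by
  set R := Finset.univ.filter fun x => adj p s l a b x = 0 with hR
  have hpos : 1 ≤ p ^ (2 * d) := Nat.one_le_pow _ _ (Fact.out : p.Prime).pos
  by_cases hne : ∃ x ∈ R, x ≠ 0
  swap
  · push Not at hne
    have : R ⊆ {0} := fun x hx => by simpa using hne x hx
    exact (Finset.card_le_card this).trans (by simpa using Nat.mul_le_mul hpos hpos)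
  obtain ⟨x, hxR, hx⟩ := hne
  have hxa : adj p s l a b x = 0 := by simpa [hR] using hxR
  rw [H.adj_eq_zero_iff] at hxa
  have hτ : ∀ {y : F}, y ≠ 0 → y ^ p ^ (s + l) ≠ 0 := fun h => pow_ne_zero _ h
  have hb : b ≠ 0 := by
    rintro rfl
    have ha : a ≠ 0 := hab.resolve_right (by simp)
    have h0 : (0 : F) ^ p ^ l = 0 := zero_pow (pow_pos (Fact.out : p.Prime).pos _).ne'
    simp only [h0, zero_mul, zero_add, add_zero] at hxa
    exact mul_ne_zero (pow_ne_zero _ ha) (hτ hx) hxa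
  have key : ∀ y ∈ R, b * x * ((y / x) ^ p ^ (s + l) - y / x) = b ^ p ^ l *
      (x ^ p ^ (s + l)) ^ p ^ (s + l) * ((y / x) ^ p ^ (s + l) - y / x) ^ p ^ (s + l) := by
    intro y hy
    have hya : adj p s l a b y = 0 := by simpa [hR] using hy
    obtain ⟨w, rfl⟩ : ∃ w, y = w * x := ⟨y / x, (div_mul_cancel₀ _ hx).symm⟩
    rw [H.adj_eq_zero_iff] at hya
    rw [mul_div_cancel_right₀ _ hx, sub_pow_char_pow]
    simp only [mul_pow] at hya
    linear_combination hxa * w ^ p ^ (s + l) - hya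
  set g : F → F := fun y => (y / x) ^ p ^ (s + l) - y / x with hg
  have hK := card_pow_eq_self H.card H.two_d_dvd
  have hfib : ∀ z, (R.filter fun y => g y = z).card ≤ p ^ (2 * d) := by
    intro z
    by_cases hz : ∃ y0 ∈ R, g y0 = z
    swap
    · rw [Finset.filter_eq_empty_iff.2 fun y hy h => hz ⟨y, hy, h⟩]
      simp
    obtain ⟨y0, -, rfl⟩ := hz
    rw [← hK]
    refine Finset.card_le_card_of_injOn (fun y => y / x - y0 / x) ?_ ?_
    · intro y hy
      have hy2 := (Finset.mem_filter.1 hy).2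
      simp only [Finset.coe_filter, Finset.mem_univ, true_and, Set.mem_ofPred_eq]
      refine H.pow_two_d_of_pow_add ?_
      rw [sub_pow_char_pow]
      simp only [hg] at hy2
      linear_combination hy2
    · intro y _ y' _ h
      exact (div_left_inj' hx).1 (sub_left_injective h)
  have himg : (R.image g).card ≤ p ^ (2 * d) := by
    by_cases hz : ∃ y0 ∈ R, g y0 ≠ 0
    swap
    · push Not at hz
      have : R.image g ⊆ {0} := by
        intro z hz'
        obtain ⟨y, hy, rfl⟩ := Finset.mem_image.1 hz'
        simpa using hz y hy
      exact (Finset.card_le_card this).trans (by simpa using hpos)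
    obtain ⟨y0, hy0, hy0'⟩ := hz
    rw [← hK]
    refine Finset.card_le_card_of_injOn (fun z => z / g y0) ?_ ?_
    · intro z hz
      obtain ⟨y, hy, rfl⟩ := Finset.mem_image.1 (Finset.mem_coe.1 hz)
      simp only [Finset.coe_filter, Finset.mem_univ, true_and, Set.mem_ofPred_eq]
      refine H.pow_two_d_of_pow_add ?_
      have e1 := key y hy
      have e2 := key y0 hy0
      change b * x * g y = _ * g y ^ _ at e1
      change b * x * g y0 = _ * g y0 ^ _ at e2
      rw [div_pow, div_eq_div_iff (hτ hy0') hy0']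
      refine mul_left_cancel₀ (mul_ne_zero (pow_ne_zero (p ^ l) hb) (hτ (hτ hx))) ?_
      linear_combination g y * e2 - g y0 * e1
    · intro y _ y' _ h
      exact (div_left_inj' hy0').1 h
  calc R.card = ∑ z ∈ R.image g, (R.filter fun y => g y = z).card :=
        Finset.card_eq_sum_card_image g R
    _ ≤ ∑ z ∈ R.image g, p ^ (2 * d) := Finset.sum_le_sum fun z _ => hfib z
    _ ≤ p ^ (2 * d) * p ^ (2 * d) := by
        rw [Finset.sum_const, smul_eq_mul]
        exact Nat.mul_le_mul_right _ himg

theorem exists_card_radical_eq_pow [DecidableEq F] (H : KasamiParams p s l d F) (a b : F) :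
    ∃ j, (Finset.univ.filter fun x => adj p s l a b x = 0).card = (p ^ (2 * d)) ^ j := by
  let K : Subfield F := RingHom.eqLocusField (iterateFrobenius F p (2 * d)) (RingHom.id F)
  have hK : ∀ y : K, (y : F) ^ p ^ (2 * d) = y := fun y => y.2
  let R : Submodule K F :=
    { (adj p s l a b).ker with
      smul_mem' := fun y x hx => H.adj_mul hx (hK y) }
  have h := Module.natCard_eq_pow_finrank (K := K) (V := R)
  refine ⟨Module.finrank K R, ?_⟩
  have h1 : Nat.card K = p ^ (2 * d) := by
    rw [← card_pow_eq_self H.card H.two_d_dvd]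
    exact Nat.subtype_card _ (by simp; intro x; rfl)
  have h2 : Nat.card R = (Finset.univ.filter fun x => adj p s l a b x = 0).card :=
    Nat.subtype_card _ (by simp; intro x; rfl)
  rw [← h1, ← h, ← h2]

theorem qf_mul (H : KasamiParams p s l d F) {u : F} (hu : u ^ p ^ (2 * d) = u) (n : ℕ)
    (hn : u ^ (p ^ d + 1) = n) (a b x : F) :
    qf p s l a b (u * x) = n * qf p s l a b x := by
  obtain ⟨k, -, hk⟩ := H.s_eq
  obtain ⟨j, hj⟩ := H.l_eq
  have e1 : u ^ (p ^ s + 1) = n := by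
    rw [pow_succ, hk, pow_odd_mul_of_pow_two hu, ← pow_succ, hn]
  have e2 : u ^ (p ^ l + 1) = n := by
    rw [pow_succ, hj, pow_odd_mul_of_pow_two hu, ← pow_succ, hn]
  rw [qf, qf, mul_pow, mul_pow, e1, e2, ← absTr_natCast_mul]
  congr 1
  ring

theorem pow_add_one_mul (H : KasamiParams p s l d F) :
    ∃ c, Fintype.card F - 1 = (p ^ d + 1) * ((p ^ d - 1) * c) := by
  obtain ⟨c, hc⟩ := pow_sub_one_dvd_card H.card H.two_d_dvd
  refine ⟨c, ?_⟩
  rw [hc, ← mul_assoc]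
  congr 1
  rw [two_mul, pow_add]
  have := Nat.sq_sub_sq (p ^ d) 1
  rwa [sq, one_pow] at this

theorem pow_add_one_dvd (H : KasamiParams p s l d F) : p ^ d + 1 ∣ Fintype.card F - 1 :=
  Dvd.intro _ H.pow_add_one_mul.choose_spec.symm

variable [DecidableEq F]

theorem exists_pow_add_one_eq (H : KasamiParams p s l d F) {v : ZMod p} (hv : v ≠ 0) :
    ∃ u : F, u ≠ 0 ∧ u ^ p ^ (2 * d) = u ∧ u ^ (p ^ d + 1) = v.val := by
  obtain ⟨c, hc⟩ := H.pow_add_one_mul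
  have hcast : ((v.val : ℕ) : F) ≠ 0 := by
    rw [Ne, CharP.cast_eq_zero_iff F p, ← CharP.cast_eq_zero_iff (ZMod p) p]
    simpa using hv
  have hpd : ((v.val : ℕ) : F) ^ (p ^ d - 1) = 1 := by
    refine mul_right_cancel₀ hcast ?_
    rw [← pow_succ, Nat.sub_add_cancel (Nat.one_le_pow _ _ (Fact.out : p.Prime).pos),
      natCast_pow_char_pow, one_mul]
  obtain ⟨u, hu⟩ := exists_pow_eq_of_dvd H.pow_add_one_dvd hcast (by
    rw [hc, Nat.mul_div_cancel_left _ (by positivity), pow_mul, hpd, one_pow])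
  have hu0 : u ≠ 0 := by
    rintro rfl
    rw [zero_pow (by positivity)] at hu
    exact hcast hu.symm
  refine ⟨u, hu0, ?_, hu⟩
  have h1 : u ^ p ^ d = v.val / u := by
    rw [eq_div_iff hu0, ← pow_succ, hu]
  rw [two_mul, ← pow_pow_iterate, h1, div_pow, h1, natCast_pow_char_pow]
  field_simp

theorem card_qf_fiber (H : KasamiParams p s l d F) (a b : F) {v : ZMod p} (hv : v ≠ 0) :
    (Finset.univ.filter fun x => qf p s l a b x = v).card
      = (Finset.univ.filter fun x => qf p s l a b x = 1).card := by
  obtain ⟨u, hu0, hu, hn⟩ := H.exists_pow_add_one_eq hv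
  symm
  refine Finset.card_bij (fun x _ => u * x) ?_ ?_ ?_
  · intro x hx
    simp only [Finset.mem_filter, Finset.mem_univ, true_and] at hx ⊢
    rw [H.qf_mul hu _ hn, hx]
    simp
  · intro x _ y _ h
    exact mul_left_cancel₀ hu0 h
  · intro y hy
    simp only [Finset.mem_filter, Finset.mem_univ, true_and] at hy
    obtain ⟨x, rfl⟩ : ∃ x, y = u * x := ⟨y / u, (mul_div_cancel₀ _ hu0).symm⟩
    rw [H.qf_mul hu _ hn] at hy
    simp only [ZMod.natCast_val, ZMod.cast_id', id_eq] at hy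
    refine ⟨x, ?_, rfl⟩
    simpa using mul_left_cancel₀ hv (hy.trans (mul_one v).symm)

variable (p s l) in
/-- The exponential sum of the form `qf`, which is a rational integer. -/
noncomputable def _root_.expSum (a b : F) : ℤ :=
  Fintype.card F - p * (Finset.univ.filter fun x => qf p s l a b x = 1).card

theorem card_qf_ne (H : KasamiParams p s l d F) (a b : F) {v : ZMod p} (hv : v ≠ 0) :
    (p : ℤ) * (Finset.univ.filter fun x => qf p s l a b x = v).card
      = Fintype.card F - expSum p s l a b := by
  rw [H.card_qf_fiber a b hv, expSum]
  ring

theorem card_qf_zero (H : KasamiParams p s l d F) (a b : F) :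
    (p : ℤ) * (Finset.univ.filter fun x => qf p s l a b x = 0).card
      = Fintype.card F + (p - 1) * expSum p s l a b := by
  rw [quad_fiber_zero _ fun v hv => H.card_qf_fiber a b hv, expSum]
  ring

theorem expSum_sq (H : KasamiParams p s l d F) {a : F} (ha : a ^ p ^ s = a) (b : F) :
    expSum p s l a b ^ 2 = Fintype.card F *
      (Finset.univ.filter fun x => adj p s l a b x = 0).card := by
  classical
  have h0 : ∀ z, (AddMonoidHom.comp (absTr p) (AddMonoidHom.mulLeft (adj p s l a b z)) = 0)
      ↔ adj p s l a b z = 0 := by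
    intro z
    constructor
    · intro h
      exact absTr_eq_zero_of_forall fun y => DFunLike.congr_fun h y
    · intro h
      ext y
      simp [h]
  have := quad_sq (qf p s l a b)
    (fun z => AddMonoidHom.comp (absTr p) (AddMonoidHom.mulLeft (adj p s l a b z)))
    (fun x z => H.qf_add ha b x z) (fun z hz => H.qf_eq_zero_of_adj ha ((h0 z).1 hz))
    (fun v hv => H.card_qf_fiber a b hv)
  simp only [h0] at this
  exact this

theorem dvd_expSum_sub_one (H : KasamiParams p s l d F) (a b : F) :
    (p : ℤ) ^ d + 1 ∣ expSum p s l a b - 1 := by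
  have h1 : p ^ d + 1 ∣ (Finset.univ.filter fun x => qf p s l a b x = 1).card := by
    refine dvd_card_filter_of_pow H.pow_add_one_dvd _ (by rw [qf_map_zero]; exact zero_ne_one) ?_
    intro x y hxy hx
    obtain ⟨k, -, hk⟩ := H.s_eq
    obtain ⟨j, hj⟩ := H.l_eq
    have e : ∀ n, x ^ (p ^ (d * (2 * n + 1)) + 1) = y ^ (p ^ (d * (2 * n + 1)) + 1) := by
      intro n
      have : p ^ d + 1 ∣ p ^ (d * (2 * n + 1)) + 1 := by
        have := Odd.nat_add_dvd_pow_add_pow (p ^ d) 1 (n := 2 * n + 1) ⟨n, rfl⟩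
        rwa [one_pow, ← pow_mul] at this
      obtain ⟨c, hc⟩ := this
      rw [hc, pow_mul, hxy, ← pow_mul]
    rw [← hx, qf, qf, hk, hj, e, e]
  have h2 := H.pow_add_one_dvd
  have hc := Fintype.one_lt_card (α := F)
  have h1' : (p : ℤ) ^ d + 1 ∣ ((Finset.univ.filter fun x => qf p s l a b x = 1).card : ℤ) := by
    exact_mod_cast h1
  have h2' : (p : ℤ) ^ d + 1 ∣ (Fintype.card F : ℤ) - 1 := by
    have : ((p ^ d + 1 : ℕ) : ℤ) ∣ ((Fintype.card F - 1 : ℕ) : ℤ) := by exact_mod_cast h2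
    rw [Nat.cast_sub hc.le] at this
    exact_mod_cast this
  have : expSum p s l a b - 1 = ((Fintype.card F : ℤ) - 1)
      - p * (Finset.univ.filter fun x => qf p s l a b x = 1).card := by
    rw [expSum]; ring
  rw [this]
  exact dvd_sub h2' (h1'.mul_left _)

theorem expSum_values (H : KasamiParams p s l d F) {a b : F} (ha : a ^ p ^ s = a)
    (hab : a ≠ 0 ∨ b ≠ 0) :
    (expSum p s l a b = -(p : ℤ) ^ s ∧
      (Finset.univ.filter fun x => adj p s l a b x = 0).card = 1) ∨
    (expSum p s l a b = (p : ℤ) ^ s * p ^ d ∧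
      (Finset.univ.filter fun x => adj p s l a b x = 0).card = (p ^ d) ^ 2) ∨
    (expSum p s l a b = -((p : ℤ) ^ s * (p ^ d) ^ 2) ∧
      (Finset.univ.filter fun x => adj p s l a b x = 0).card = (p ^ d) ^ 4) := by
  have hsq := H.expSum_sq ha b
  obtain ⟨j, hj⟩ := H.exists_card_radical_eq_pow a b
  have hle := H.card_radical_le hab
  have hdvd := H.dvd_expSum_sub_one a b
  have hp3 : 3 ≤ p := by
    have h2 := (Fact.out : p.Prime).two_le
    have : p ≠ 2 := by rintro rfl; exact absurd H.odd (by decide)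
    omega
  have hD : (3 : ℤ) ≤ (p : ℤ) ^ d := by
    have : p ^ 1 ≤ p ^ d := Nat.pow_le_pow_right (by omega) H.d_pos
    have : 3 ≤ p ^ d := by rw [pow_one] at this; omega
    exact_mod_cast this
  have hP : (p : ℤ) ^ d + 1 ∣ (p : ℤ) ^ s + 1 := by
    obtain ⟨k, -, hk⟩ := H.s_eq
    have := Odd.add_dvd_pow_add_pow ((p : ℤ) ^ d) 1 (n := 2 * k + 1) ⟨k, rfl⟩
    rwa [one_pow, ← pow_mul, ← hk] at this
  have hj2 : j ≤ 2 := by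
    rw [hj, ← sq] at hle
    exact (Nat.pow_le_pow_iff_right (Nat.one_lt_pow (by have := H.d_pos; omega) (by omega))).1 hle
  have e2d : p ^ (2 * d) = (p ^ d) ^ 2 := by rw [← pow_mul, mul_comm]
  rw [hj] at hsq ⊢
  rw [H.card, e2d] at hsq
  rw [e2d]
  set S := expSum p s l a b
  set P : ℤ := (p : ℤ) ^ s with hPdef
  set D : ℤ := (p : ℤ) ^ d with hDdef
  have hq : ((p ^ (2 * s) : ℕ) : ℤ) = P ^ 2 := by
    push_cast
    rw [hPdef, ← pow_mul, mul_comm]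
  have hfac : (S - P * D ^ j) * (S + P * D ^ j) = 0 := by
    rw [hq] at hsq
    push_cast at hsq
    rw [← hDdef, pow_right_comm D 2 j] at hsq
    linear_combination hsq
  have hno : ¬ (D + 1 ∣ 2) := fun h => by
    have := Int.le_of_dvd (by norm_num) h
    omega
  obtain ⟨r, hr⟩ := hP
  obtain ⟨t, ht⟩ := hdvd
  interval_cases j
  · left
    refine ⟨?_, by simp⟩
    rcases mul_eq_zero.1 hfac with h | h
    · exact absurd ⟨r - t, by linear_combination hr - ht + h⟩ hno
    · linear_combination h
  · right; left
    refine ⟨?_, by simp⟩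
    rcases mul_eq_zero.1 hfac with h | h
    · linear_combination h
    · exact absurd ⟨1 - t - D * r, by linear_combination h - ht - D * hr⟩ hno
  · right; right
    refine ⟨?_, by ring⟩
    rcases mul_eq_zero.1 hfac with h | h
    · exact absurd ⟨D ^ 2 * r - t - (D - 1), by linear_combination D ^ 2 * hr - ht + h⟩ hno
    · linear_combination h

end KasamiParams

end Form

section Moments

variable {p s l d : ℕ} [Fact p.Prime] {F : Type} [Field F] [CharP F p] [Fintype F] [DecidableEq F]

namespace KasamiParams

theorem pow_l_eq_neg_iff (H : KasamiParams p s l d F) {u : F} (hu : u ^ p ^ s = -u) :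
    u ^ p ^ l = -u ↔ u ^ p ^ d = -u := by
  obtain ⟨k, -, hk⟩ := H.s_eq
  obtain ⟨j, hj⟩ := H.l_eq
  constructor
  · intro h
    have h2 : u ^ p ^ (2 * d) = u := by
      refine H.pow_two_d_of_pow_add ?_
      rw [← pow_pow_iterate, hu, (H.odd.pow).neg_pow, h, neg_neg]
    rw [← hu, hk, pow_odd_mul_of_pow_two h2]
  · intro h
    rw [hj, pow_eq_neg_odd_mul H.odd h]

theorem half_mul_two (_H : KasamiParams p s l d F) (u : F) (n : ℕ) :
    (u / 2) ^ p ^ n = u ^ p ^ n / 2 := by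
  have : (2 : F) ^ p ^ n = 2 := by exact_mod_cast natCast_pow_char_pow (p := p) (F := F) 2 n
  rw [div_pow, this]

theorem card_pow_sub (H : KasamiParams p s l d F) :
    (Finset.univ.filter fun w : F => (w ^ p ^ s - w) ^ p ^ l = -(w ^ p ^ s - w)).card
      = p ^ s * p ^ d := by
  have h2 := H.two_ne_zero
  obtain ⟨k, -, hk⟩ := H.s_eq
  have hss : ∀ w : F, (w ^ p ^ s) ^ p ^ s = w := fun w => by
    rw [pow_pow_iterate, ← two_mul, pow_card_self H.card]
  have hcard : ((Finset.univ.filter fun x : F => x ^ p ^ s = x) ×ˢ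
      (Finset.univ.filter fun x : F => x ^ p ^ d = -x)).card = p ^ s * p ^ d := by
    rw [Finset.card_product, card_pow_eq_self H.card (dvd_mul_left s 2),
      card_pow_eq_neg H.odd H.card H.two_d_dvd]
  refine Eq.trans ?_ hcard
  refine Finset.card_bij (fun w _ => ((w ^ p ^ s + w) / 2, w ^ p ^ s - w)) ?_ ?_ ?_
  · intro w hw
    simp only [Finset.mem_filter, Finset.mem_univ, true_and, Finset.mem_product] at hw ⊢
    have hu : (w ^ p ^ s - w) ^ p ^ s = -(w ^ p ^ s - w) := by
      rw [sub_pow_char_pow, hss]; ring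
    refine ⟨?_, (H.pow_l_eq_neg_iff hu).1 hw⟩
    rw [H.half_mul_two, add_pow_char_pow, hss, add_comm]
  · intro w _ w' _ h
    simp only [Prod.mk.injEq, div_left_inj' h2] at h
    have : 2 * w = 2 * w' := by linear_combination h.1 - h.2
    exact mul_left_cancel₀ h2 this
  · rintro ⟨e, u⟩ h
    simp only [Finset.mem_filter, Finset.mem_univ, true_and, Finset.mem_product] at h
    obtain ⟨he, hu⟩ := h
    have hus : u ^ p ^ s = -u := by rw [hk]; exact pow_eq_neg_odd_mul H.odd hu k
    have hw : (e - u / 2) ^ p ^ s = e + u / 2 := by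
      rw [sub_pow_char_pow, he, H.half_mul_two, hus]; ring
    have hd : (e - u / 2) ^ p ^ s - (e - u / 2) = u := by
      rw [hw]; field_simp; ring
    refine ⟨e - u / 2, ?_, ?_⟩
    · simp only [Finset.mem_filter, Finset.mem_univ, true_and]
      rw [hd, (H.pow_l_eq_neg_iff hus).2 hu]
    · rw [Prod.mk.injEq]
      refine ⟨?_, hd⟩
      rw [hw]
      field_simp
      ring

theorem card_adj_eq_zero (H : KasamiParams p s l d F) {x : F} (hx : x ≠ 0) :
    (Finset.univ.filter fun t : F × F => t.1 ^ p ^ s = t.1 ∧ adj p s l t.1 t.2 x = 0).card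
      = p ^ s * p ^ d := by
  have hss : ∀ w : F, (w ^ p ^ s) ^ p ^ s = w := fun w => by
    rw [pow_pow_iterate, ← two_mul, pow_card_self H.card]
  have hll : ∀ w : F, (w ^ p ^ (2 * s - l)) ^ p ^ l = w := fun w => by
    rw [pow_pow_iterate, Nat.sub_add_cancel H.l_le, pow_card_self H.card]
  have hll' : ∀ w : F, (w ^ p ^ l) ^ p ^ (2 * s - l) = w := fun w => by
    rw [pow_pow_iterate, add_comm, Nat.sub_add_cancel H.l_le, pow_card_self H.card]
  have hcomm : ∀ (w : F) (m n : ℕ), (w ^ p ^ m) ^ p ^ n = (w ^ p ^ n) ^ p ^ m := fun w m n => by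
    rw [pow_pow_iterate, pow_pow_iterate, add_comm]
  have hP : ∀ n, p ^ n ≠ 0 := fun n => (pow_pos (Fact.out : p.Prime).pos _).ne'
  have hcond : ∀ w : F, (w ^ p ^ s - w) ^ p ^ l = -(w ^ p ^ s - w) ↔
      (w + w ^ p ^ (2 * s - l)) ^ p ^ s = w + w ^ p ^ (2 * s - l) := by
    intro w
    rw [← (pow_char_pow_injective (p := p) l).eq_iff (a := (w + w ^ p ^ (2 * s - l)) ^ p ^ s)]
    simp only [add_pow_char_pow, sub_pow_char_pow]
    rw [hcomm (w ^ p ^ (2 * s - l)) s l, hll]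
    constructor <;> intro h <;> linear_combination h
  have hN : (x ^ (p ^ s + 1)) ^ p ^ s = x ^ (p ^ s + 1) := by
    rw [pow_succ, mul_pow, hss, mul_comm]
  have hN0 : x ^ (p ^ s + 1) ≠ 0 := pow_ne_zero _ hx
  have hM0 : x ^ (p ^ l + 1) ≠ 0 := pow_ne_zero _ hx
  have hadj : ∀ a b, adj p s l a b x * x = a * x ^ (p ^ s + 1) + (b * x ^ (p ^ l + 1) +
      (b * x ^ (p ^ l + 1)) ^ p ^ (2 * s - l)) := by
    intro a b
    rw [adj_apply, pow_succ x (p ^ l), mul_pow b (_ * _), mul_pow (x ^ p ^ l), hll']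
    ring
  have hadj' : ∀ a b, adj p s l a b x = 0 ↔ a * x ^ (p ^ s + 1) = -(b * x ^ (p ^ l + 1) +
      (b * x ^ (p ^ l + 1)) ^ p ^ (2 * s - l)) := by
    intro a b
    rw [← mul_eq_zero_iff_right hx, hadj, add_eq_zero_iff_eq_neg]
  rw [← H.card_pow_sub]
  refine Finset.card_bij (fun t _ => t.2 * x ^ (p ^ l + 1)) ?_ ?_ ?_
  · rintro ⟨a, b⟩ h
    simp only [Finset.mem_filter, Finset.mem_univ, true_and] at h ⊢
    obtain ⟨ha, h⟩ := h
    rw [hadj'] at h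
    rw [hcond, ← neg_inj, ← h, ← (H.odd.pow).neg_pow, ← h, mul_pow, ha, hN]
  · rintro ⟨a, b⟩ h ⟨a', b'⟩ h' e
    simp only [Finset.mem_filter, Finset.mem_univ, true_and] at h h' e
    obtain rfl := mul_right_cancel₀ hM0 e
    rw [hadj'] at h h'
    rw [mul_right_cancel₀ hN0 (h.2.trans h'.2.symm)]
  · intro w hw
    simp only [Finset.mem_filter, Finset.mem_univ, true_and] at hw
    rw [hcond] at hw
    refine ⟨(-(w + w ^ p ^ (2 * s - l)) / x ^ (p ^ s + 1), w / x ^ (p ^ l + 1)), ?_, ?_⟩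
    · simp only [Finset.mem_filter, Finset.mem_univ, true_and]
      rw [hadj', div_mul_cancel₀ _ hN0, div_mul_cancel₀ _ hM0, div_pow, (H.odd.pow).neg_pow, hw, hN]
      exact ⟨rfl, rfl⟩
    · exact div_mul_cancel₀ _ hM0

variable (p s F) in
/-- The parameter space of the forms `qf`. -/
def _root_.formParams : Finset (F × F) := Finset.univ.filter fun t => t.1 ^ p ^ s = t.1

theorem card_formParams (H : KasamiParams p s l d F) :
    (formParams p s F).card = p ^ s * Fintype.card F := by
  rw [← card_pow_eq_self H.card (dvd_mul_left s 2), ← Finset.card_univ, ← Finset.card_product]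
  congr 1
  ext ⟨a, b⟩
  simp [formParams]

theorem card_qf_eq_one (H : KasamiParams p s l d F) {x : F} (hx : x ≠ 0) :
    p * ((formParams p s F).filter fun t => qf p s l t.1 t.2 x = 1).card
      = p ^ s * Fintype.card F := by
  obtain ⟨z, hz⟩ : ∃ z, absTr p (z * x ^ (p ^ l + 1)) ≠ 0 := by
    by_contra! hc
    refine pow_ne_zero (p ^ l + 1) hx (absTr_eq_zero_of_forall (p := p) fun y => ?_)
    rw [mul_comm]
    exact hc y
  have h1 : ∀ a : F, p * (Finset.univ.filter fun b => qf p s l a b x = 1).card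
      = Fintype.card F := by
    intro a
    refine card_fiber_of_shift (fun b => qf p s l a b x) z hz (fun b => ?_) 1
    simp only [qf]
    rw [← map_add]
    congr 1
    ring
  rw [Finset.card_eq_sum_card_fiberwise (f := Prod.fst)
    (t := Finset.univ.filter fun a : F => a ^ p ^ s = a)
    (by intro t ht; simpa [formParams] using And.left (by simpa [formParams] using ht)),
    Finset.mul_sum]
  have hconst : ∑ a ∈ Finset.univ.filter fun a : F => a ^ p ^ s = a, Fintype.card F
      = p ^ s * Fintype.card F := by
    rw [Finset.sum_const, card_pow_eq_self H.card (dvd_mul_left s 2), smul_eq_mul]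
  refine Eq.trans (Finset.sum_congr rfl fun a ha => ?_) hconst
  rw [← h1 a]
  congr 1
  refine Finset.card_bij (fun t _ => t.2) ?_ ?_ ?_
  · rintro ⟨a', b⟩ h
    simp only [Finset.mem_filter, Finset.mem_univ, true_and] at h ⊢
    rw [← h.2]
    exact h.1.2
  · rintro ⟨a', b⟩ h ⟨a'', b'⟩ h' e
    simp only [Finset.mem_filter] at h h' e
    rw [h.2, h'.2, e]
  · intro b hb
    simp only [Finset.mem_filter, Finset.mem_univ, true_and] at ha hb
    exact ⟨(a, b), by simp [formParams, ha, hb], rfl⟩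

theorem sum_expSum (H : KasamiParams p s l d F) :
    ∑ t ∈ formParams p s F, expSum p s l t.1 t.2 = (p : ℤ) ^ s * Fintype.card F := by
  have hswap : ∑ t ∈ formParams p s F, (Finset.univ.filter fun x => qf p s l t.1 t.2 x = 1).card
      = ∑ x : F, ((formParams p s F).filter fun t => qf p s l t.1 t.2 x = 1).card := by
    simp only [Finset.card_filter]
    exact Finset.sum_comm
  have h0 : ((formParams p s F).filter fun t => qf p s l t.1 t.2 0 = 1).card = 0 := by
    simp [qf_map_zero]
  rw [← Finset.add_sum_erase _ _ (Finset.mem_univ (0 : F)), h0, zero_add] at hswap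
  have h1 : p * ∑ t ∈ formParams p s F, (Finset.univ.filter fun x => qf p s l t.1 t.2 x = 1).card
      = (Fintype.card F - 1) * (p ^ s * Fintype.card F) := by
    rw [hswap, Finset.mul_sum,
      Finset.sum_congr rfl fun x hx => H.card_qf_eq_one (Finset.ne_of_mem_erase hx),
      Finset.sum_const, Finset.card_erase_of_mem (Finset.mem_univ _), Finset.card_univ, smul_eq_mul]
  simp only [expSum]
  rw [Finset.sum_sub_distrib, ← Finset.mul_sum, Finset.sum_const, H.card_formParams]
  have h2 := congrArg (Nat.cast : ℕ → ℤ) h1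
  push_cast [Nat.cast_sub (Fintype.one_lt_card (α := F)).le] at h2
  rw [h2, nsmul_eq_mul]
  push_cast
  ring

theorem sum_card_radical (H : KasamiParams p s l d F) :
    ∑ t ∈ formParams p s F, ((Finset.univ.filter fun x => adj p s l t.1 t.2 x = 0).card : ℤ)
      = (p : ℤ) ^ s * Fintype.card F + (Fintype.card F - 1) * (p ^ s * p ^ d) := by
  have hswap : ∑ t ∈ formParams p s F, (Finset.univ.filter fun x => adj p s l t.1 t.2 x = 0).card
      = ∑ x : F, ((formParams p s F).filter fun t => adj p s l t.1 t.2 x = 0).card := by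
    simp only [Finset.card_filter]
    exact Finset.sum_comm
  have h0 : ((formParams p s F).filter fun t => adj p s l t.1 t.2 0 = 0).card
      = p ^ s * Fintype.card F := by
    simp [H.card_formParams]
  have h1 : ∀ x : F, x ≠ 0 → ((formParams p s F).filter fun t => adj p s l t.1 t.2 x = 0).card
      = p ^ s * p ^ d := by
    intro x hx
    rw [formParams, Finset.filter_filter, H.card_adj_eq_zero hx]
  rw [← Finset.add_sum_erase _ _ (Finset.mem_univ (0 : F)), h0,
    Finset.sum_congr rfl fun x hx => h1 x (Finset.ne_of_mem_erase hx),
    Finset.sum_const, Finset.card_erase_of_mem (Finset.mem_univ _), Finset.card_univ,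
    smul_eq_mul] at hswap
  have h2 := congrArg (Nat.cast : ℕ → ℤ) hswap
  push_cast [Nat.cast_sub (Fintype.one_lt_card (α := F)).le] at h2
  exact h2

theorem expSum_zero : expSum p s l (0 : F) 0 = Fintype.card F := by
  simp [expSum, qf_zero]

variable (p s l d F) in
/-- The parameters of the forms of smallest nonzero rank. -/
noncomputable def _root_.minParams : Finset (F × F) :=
  ((formParams p s F).erase 0).filter fun t =>
    expSum p s l t.1 t.2 = -((p : ℤ) ^ s * (p ^ d) ^ 2)

theorem card_minParams (H : KasamiParams p s l d F) :
    ((minParams p s l d F).card : ℤ) * (((p : ℤ) ^ d) ^ 2 - 1) * p ^ d * (p ^ d + 1)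
      = (((p : ℤ) ^ s) ^ 2 - 1) * (p ^ s - p ^ d) := by
  have hzero : (0 : F × F) ∈ formParams p s F := by
    have hP : p ^ s ≠ 0 := (pow_pos (Fact.out : p.Prime).pos _).ne'
    simp [formParams, zero_pow hP]
  have hq : (Fintype.card F : ℤ) = ((p : ℤ) ^ s) ^ 2 := by
    rw [H.card]; push_cast; rw [← pow_mul, mul_comm]
  have m0 := H.card_formParams
  have m1 := H.sum_expSum
  have m2 : ∑ t ∈ formParams p s F, expSum p s l t.1 t.2 ^ 2 = Fintype.card F *
      ((p : ℤ) ^ s * Fintype.card F + (Fintype.card F - 1) * (p ^ s * p ^ d)) := by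
    rw [← H.sum_card_radical, Finset.mul_sum]
    exact Finset.sum_congr rfl fun t ht =>
      H.expSum_sq (by simpa [formParams] using ht) t.2
  have m0' : (((formParams p s F).erase 0).card : ℤ) = (p : ℤ) ^ s * Fintype.card F - 1 := by
    rw [Finset.card_erase_of_mem hzero, Nat.cast_sub (Finset.card_pos.2 ⟨_, hzero⟩), m0]
    push_cast
    ring
  rw [← Finset.add_sum_erase _ _ hzero] at m1 m2
  simp only [Prod.fst_zero, Prod.snd_zero, expSum_zero] at m1 m2
  have key : ∑ t ∈ (formParams p s F).erase 0, (expSum p s l t.1 t.2 + p ^ s) *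
      (expSum p s l t.1 t.2 - p ^ s * p ^ d) = (minParams p s l d F).card *
        (((p : ℤ) ^ s) ^ 2 * ((p ^ d) ^ 2 - 1) * p ^ d * (p ^ d + 1)) := by
    rw [minParams, ← nsmul_eq_mul, ← Finset.sum_const, Finset.sum_filter]
    refine Finset.sum_congr rfl fun t ht => ?_
    obtain ⟨ht0, ht⟩ := Finset.mem_erase.1 ht
    have hab : t.1 ≠ 0 ∨ t.2 ≠ 0 := by
      by_contra! hc
      exact ht0 (Prod.ext hc.1 hc.2)
    have hv := H.expSum_values (by simpa [formParams] using ht) hab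
    split_ifs with hS
    · rw [hS]; ring
    · rcases hv with hv | hv | hv
      · rw [hv.1]; ring
      · rw [hv.1]; ring
      · exact absurd hv.1 hS
  have expand : ∑ t ∈ (formParams p s F).erase 0, (expSum p s l t.1 t.2 + p ^ s) *
      (expSum p s l t.1 t.2 - p ^ s * p ^ d)
      = ∑ t ∈ (formParams p s F).erase 0, expSum p s l t.1 t.2 ^ 2
        + ((p : ℤ) ^ s - p ^ s * p ^ d) * ∑ t ∈ (formParams p s F).erase 0, expSum p s l t.1 t.2
        - ((formParams p s F).erase 0).card * (p ^ s * (p ^ s * p ^ d)) := by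
    rw [Finset.mul_sum, ← nsmul_eq_mul, ← Finset.sum_const, ← Finset.sum_add_distrib,
      ← Finset.sum_sub_distrib]
    exact Finset.sum_congr rfl fun t _ => by ring
  rw [key, m0'] at expand
  rw [hq] at *
  have hP : ((p : ℤ) ^ s) ^ 2 ≠ 0 :=
    pow_ne_zero _ (pow_ne_zero _ (by exact_mod_cast (Fact.out : p.Prime).ne_zero))
  apply mul_left_cancel₀ hP
  linear_combination expand + m2 + ((p : ℤ) ^ s - p ^ s * p ^ d) * m1

end KasamiParams

end Moments

section Words

variable (p s l : ℕ) [Fact p.Prime] {F : Type} [Field F] [CharP F p]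

/-- The coordinate at `x` of the codeword with parameters `t = (a, b, c, h)`, with values in
`ZMod p` and as an additive function of `t`. -/
noncomputable def coord (x : F) : F × F × F × ZMod p →+ ZMod p :=
  AddMonoidHom.mk' (fun t => qf p s l t.1 t.2.1 x + absTr p (t.2.2.1 * x) + t.2.2.2) (by
    intro t t'
    have : ∀ a a' b b' : F, qf p s l (a + a') (b + b') x = qf p s l a b x + qf p s l a' b' x := by
      intro a a' b b'
      simp only [qf]
      rw [← map_add]
      congr 1
      ring
    simp only [Prod.fst_add, Prod.snd_add, this, add_mul, map_add]
    ring)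

variable {p s l} {d : ℕ}

theorem coord_apply (x : F) (t : F × F × F × ZMod p) :
    coord p s l x t = qf p s l t.1 t.2.1 x + absTr p (t.2.2.1 * x) + t.2.2.2 := rfl

variable [Fintype F] [DecidableEq F]

variable (p s l) in
/-- The zero coordinates of the codeword with parameters `t`. -/
noncomputable def zeros (t : F × F × F × ZMod p) : Finset F :=
  Finset.univ.filter fun x => coord p s l x t = 0

theorem mem_zeros {t : F × F × F × ZMod p} {x : F} :
    x ∈ zeros p s l t ↔ coord p s l x t = 0 := by
  simp [zeros]

namespace KasamiParams

theorem cword_eq_cast (H : KasamiParams p s l d F) {t : F × F × F × ZMod p}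
    (ht : t.1 ^ p ^ s = t.1) (x : F) :
    cword p s l t.1 t.2.1 t.2.2.1 t.2.2.2 x = (ZMod.cast (coord p s l x t) : F) := by
  obtain ⟨a, b, c, h⟩ := t
  simp only at ht
  have h2 := H.two_ne_zero
  have e1 : trp p s (a * x ^ (p ^ s + 1)) = trp p (2 * s) (a / 2 * x ^ (p ^ s + 1)) := by
    have hz : (a * x ^ (p ^ s + 1)) ^ p ^ s = a * x ^ (p ^ s + 1) := by
      rw [mul_pow, ht, pow_succ, mul_pow, pow_pow_iterate, ← two_mul, pow_card_self H.card,
        mul_comm x]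
    have hz' : a / 2 * x ^ (p ^ s + 1) = (a * x ^ (p ^ s + 1)) / 2 := by ring
    rw [hz']
    set z := a * x ^ (p ^ s + 1)
    rw [trp, trp, two_mul, Finset.sum_range_add]
    simp only [H.half_mul_two, ← pow_pow_iterate z s, hz]
    rw [← Finset.sum_add_distrib]
    refine Finset.sum_congr rfl fun i _ => ?_
    field_simp
    ring
  have hadd : ∀ u v : ZMod p, (ZMod.cast (u + v) : F) = ZMod.cast u + ZMod.cast v :=
    map_add (ZMod.castHom (dvd_refl p) F)
  simp only [cword, coord_apply]
  rw [e1, ← cast_absTr H.card, ← cast_absTr H.card, ← hadd, ← hadd]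
  simp only [qf, map_add]
  congr 1
  ring

theorem mem_suppw (H : KasamiParams p s l d F) {t : F × F × F × ZMod p}
    (ht : t.1 ^ p ^ s = t.1) (x : F) :
    x ∈ suppw p s l t.1 t.2.1 t.2.2.1 t.2.2.2 ↔ coord p s l x t ≠ 0 := by
  simp only [suppw, Finset.mem_filter, Finset.mem_univ, true_and, H.cword_eq_cast ht]
  exact (map_ne_zero (ZMod.castHom (dvd_refl p) F))

theorem suppw_eq_compl (H : KasamiParams p s l d F) {t : F × F × F × ZMod p}
    (ht : t.1 ^ p ^ s = t.1) : suppw p s l t.1 t.2.1 t.2.2.1 t.2.2.2 = (zeros p s l t)ᶜ := by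
  ext x
  simp [H.mem_suppw ht, zeros]

theorem card_zeros_adj (H : KasamiParams p s l d F) {a : F} (ha : a ^ p ^ s = a) (b x0 : F)
    (h : ZMod p) : (zeros p s l (a, b, adj p s l a b x0, h)).card
      = (Finset.univ.filter fun y => qf p s l a b y = qf p s l a b x0 - h).card := by
  refine Finset.card_bij (fun x _ => x + x0) ?_ ?_ ?_
  · intro x hx
    rw [mem_zeros, coord_apply] at hx
    refine Finset.mem_filter.2 ⟨Finset.mem_univ _, ?_⟩
    rw [H.qf_add ha]
    linear_combination hx
  · intro x _ y _ hxy
    exact add_right_cancel hxy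
  · intro y hy
    refine ⟨y - x0, ?_, sub_add_cancel _ _⟩
    rw [mem_zeros, coord_apply]
    have hy := (Finset.mem_filter.1 hy).2
    have := H.qf_add ha b (y - x0) x0
    rw [sub_add_cancel] at this
    linear_combination hy - this

theorem card_zeros_cases (H : KasamiParams p s l d F) {t : F × F × F × ZMod p}
    (ht : t.1 ^ p ^ s = t.1) (ht0 : t ≠ 0) :
    (zeros p s l t).card = 0 ∨ (p : ℤ) * (zeros p s l t).card = Fintype.card F ∨
    (t.1 ≠ 0 ∨ t.2.1 ≠ 0) ∧ ∃ x, adj p s l t.1 t.2.1 x = t.2.2.1 ∧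
      (qf p s l t.1 t.2.1 x ≠ t.2.2.2 ∧
        (p : ℤ) * (zeros p s l t).card = Fintype.card F - expSum p s l t.1 t.2.1 ∨
      qf p s l t.1 t.2.1 x = t.2.2.2 ∧
        (p : ℤ) * (zeros p s l t).card = Fintype.card F + (p - 1) * expSum p s l t.1 t.2.1) := by
  obtain ⟨a, b, c, h⟩ := t
  simp only at ht ⊢
  by_cases hc : ∃ x, adj p s l a b x = c
  swap
  · right; left
    push Not at hc
    obtain ⟨z, hz, hz'⟩ := exists_absTr_ne_zero_of_notMem_range _
      (fun x y => H.adj_symm ht b x y) hc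
    have := card_fiber_of_shift (fun x => coord p s l x (a, b, c, h)) z hz' (fun x => by
      simp only [coord_apply]
      rw [H.qf_add ht, hz, H.qf_eq_zero_of_adj ht hz, mul_add, map_add]
      simp
      ring) 0
    exact_mod_cast this
  obtain ⟨x0, rfl⟩ := hc
  by_cases hab : a ≠ 0 ∨ b ≠ 0
  swap
  · left
    push Not at hab
    obtain ⟨rfl, rfl⟩ := hab
    have hadj : ∀ x : F, adj p s l 0 0 x = 0 := by
      intro x
      have hP : p ^ (2 * s - l) ≠ 0 := (pow_pos (Fact.out : p.Prime).pos _).ne'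
      simp [adj_apply, zero_pow hP]
    rw [hadj] at ht0 ⊢
    have hh : h ≠ 0 := by
      rintro rfl
      exact ht0 rfl
    rw [Finset.card_eq_zero, zeros, Finset.filter_eq_empty_iff]
    intro x _
    simp [coord_apply, qf_zero, hh]
  · right; right
    refine ⟨hab, x0, rfl, ?_⟩
    rw [H.card_zeros_adj ht]
    by_cases hh : qf p s l a b x0 = h
    · right
      rw [hh, sub_self]
      exact ⟨rfl, H.card_qf_zero a b⟩
    · left
      exact ⟨hh, H.card_qf_ne a b (sub_ne_zero.2 hh)⟩

theorem three_le (H : KasamiParams p s l d F) : 3 ≤ p := by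
  have h2 := (Fact.out : p.Prime).two_le
  have : p ≠ 2 := by rintro rfl; exact absurd H.odd (by decide)
  omega

theorem le_pow_d (H : KasamiParams p s l d F) : p ≤ p ^ d :=
  Nat.le_self_pow H.d_pos.ne' p

theorem mul_sq_le_pow_s (H : KasamiParams p s l d F) : p * (p ^ d) ^ 2 ≤ p ^ s := by
  obtain ⟨k, hk1, hk⟩ := H.s_eq
  have := H.d_pos
  rw [← pow_mul, ← pow_succ']
  refine Nat.pow_le_pow_right (Fact.out : p.Prime).pos ?_
  rw [hk]
  nlinarith

theorem card_eq_sq (H : KasamiParams p s l d F) : (Fintype.card F : ℤ) = ((p : ℤ) ^ s) ^ 2 := by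
  rw [H.card]; push_cast; rw [← pow_mul, mul_comm]

theorem card_zeros_le (H : KasamiParams p s l d F) {t : F × F × F × ZMod p}
    (ht : t.1 ^ p ^ s = t.1) (ht0 : t ≠ 0) :
    (p : ℤ) * (zeros p s l t).card ≤ Fintype.card F + p ^ s * (p ^ d) ^ 2 := by
  have h1 : (3 : ℤ) ≤ p := by exact_mod_cast H.three_le
  have h2 : (p : ℤ) ≤ p ^ d := by exact_mod_cast H.le_pow_d
  have h3 : (0 : ℤ) < p ^ s := by positivity
  have h4 : (0 : ℤ) < p ^ s * (p ^ d) ^ 2 := by positivity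
  have h5 : (0 : ℤ) < p ^ s * p ^ d := by positivity
  have h6 : ((p : ℤ) - 1) * (p ^ s * p ^ d) ≤ p ^ s * (p ^ d) ^ 2 := by nlinarith
  rcases H.card_zeros_cases ht ht0 with h | h | ⟨hab, x, -, ⟨-, h⟩ | ⟨-, h⟩⟩
  · rw [h]; push_cast; nlinarith [Fintype.card_pos (α := F)]
  · linarith
  · have h7 : (1 : ℤ) ≤ (p ^ d) ^ 2 := by nlinarith
    have h8 : (p : ℤ) ^ s ≤ p ^ s * (p ^ d) ^ 2 := by nlinarith
    rcases H.expSum_values ht hab with hv | hv | hv <;> rw [h, hv.1] <;> linarith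
  · rcases H.expSum_values ht hab with hv | hv | hv <;> rw [h, hv.1] <;> nlinarith

theorem card_zeros_eq_iff (H : KasamiParams p s l d F) {t : F × F × F × ZMod p}
    (ht : t.1 ^ p ^ s = t.1) :
    (p : ℤ) * (zeros p s l t).card = Fintype.card F - (p - 1) * (p ^ s * (p ^ d) ^ 2) ↔
      (t.1, t.2.1) ∈ minParams p s l d F ∧
      ∃ x, adj p s l t.1 t.2.1 x = t.2.2.1 ∧ qf p s l t.1 t.2.1 x = t.2.2.2 := by
  have h1 : (3 : ℤ) ≤ p := by exact_mod_cast H.three_le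
  have h2 : (p : ℤ) ≤ p ^ d := by exact_mod_cast H.le_pow_d
  have h3 : (0 : ℤ) < p ^ s := by positivity
  have h4 : (0 : ℤ) < p ^ s * (p ^ d) ^ 2 := by positivity
  have h5 : (0 : ℤ) < p ^ s * p ^ d := by positivity
  have h6 : (p : ℤ) * (p ^ d) ^ 2 ≤ p ^ s := by exact_mod_cast H.mul_sq_le_pow_s
  have h7 : 0 < ((p : ℤ) - 1) * (p ^ s * (p ^ d) ^ 2) := by
    apply mul_pos <;> linarith
  have hq := H.card_eq_sq
  constructor
  · intro h
    have ht0 : t ≠ 0 := by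
      rintro rfl
      have : zeros p s l (0 : F × F × F × ZMod p) = Finset.univ := by simp [zeros]
      rw [this, Finset.card_univ, hq] at h
      nlinarith
    rcases H.card_zeros_cases ht ht0 with h' | h' | ⟨hab, x, hx, ⟨-, h'⟩ | ⟨hx', h'⟩⟩
    · exfalso
      rw [h', hq] at h
      push_cast at h
      have e : (p : ℤ) ^ s * (p ^ s - (p - 1) * (p ^ d) ^ 2) = 0 := by linear_combination -h
      rcases mul_eq_zero.1 e with e | e
      · linarith
      · have : (0 : ℤ) < (p ^ d) ^ 2 := by positivity
        nlinarith
    · exfalso; linarith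
    · exfalso
      rcases H.expSum_values ht hab with hv | hv | hv <;> rw [h', hv.1] at h
      · linarith
      · have h8 : (p : ℤ) ^ s * p ^ d = (p - 1) * (p ^ s * (p ^ d) ^ 2) := by linarith
        have h9 : (1 : ℤ) = (p - 1) * p ^ d := by
          apply mul_left_cancel₀ h5.ne'
          linear_combination h8
        nlinarith
      · linarith
    · refine ⟨?_, x, hx, hx'⟩
      have hS : expSum p s l t.1 t.2.1 = -((p : ℤ) ^ s * (p ^ d) ^ 2) := by
        have hp1 : (p : ℤ) - 1 ≠ 0 := by linarith
        apply mul_left_cancel₀ hp1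
        linear_combination h - h'
      refine Finset.mem_filter.2 ⟨Finset.mem_erase.2 ⟨?_, ?_⟩, hS⟩
      · intro h0
        simp only [Prod.mk_eq_zero] at h0
        rcases hab with hab | hab
        · exact hab h0.1
        · exact hab h0.2
      · simpa [formParams] using ht
  · rintro ⟨hm, x, hx, hx'⟩
    obtain ⟨hm, hS⟩ := Finset.mem_filter.1 hm
    obtain ⟨a, b, c, h⟩ := t
    simp only at hx hx' hS ht
    subst hx hx'
    rw [H.card_zeros_adj ht, sub_self, H.card_qf_zero, hS]
    ring

end KasamiParams

end Words

section Design

variable (p s l d : ℕ) [Fact p.Prime] (F : Type) [Field F] [CharP F p] [Fintype F] [DecidableEq F]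

/-- The parameters of the codewords with
`q - (q - (p - 1) * p ^ (s + 2 * d)) / p` nonzero coordinates. -/
noncomputable def weightSet : Finset (F × F × F × ZMod p) :=
  Finset.univ.filter fun t => t.1 ^ p ^ s = t.1 ∧
    (p : ℤ) * (zeros p s l t).card = Fintype.card F - (p - 1) * (p ^ s * (p ^ d) ^ 2)

/-- The supports of the codewords with parameters in `weightSet`. -/
noncomputable def blocks : Finset (Finset F) :=
  (weightSet p s l d F).image fun t => (zeros p s l t)ᶜ

variable {p s l d F}

theorem mem_weightSet {t : F × F × F × ZMod p} : t ∈ weightSet p s l d F ↔ t.1 ^ p ^ s = t.1 ∧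
    (p : ℤ) * (zeros p s l t).card = Fintype.card F - (p - 1) * (p ^ s * (p ^ d) ^ 2) := by
  simp [weightSet]

theorem coord_val_nsmul (x : F) (n : ZMod p) (t : F × F × F × ZMod p) :
    coord p s l x (n.val • t) = n * coord p s l x t := by
  rw [map_nsmul, nsmul_eq_mul, ZMod.natCast_zmod_val]

theorem fst_sub_nsmul {t t' : F × F × F × ZMod p} (ht : t.1 ^ p ^ s = t.1)
    (ht' : t'.1 ^ p ^ s = t'.1) (n : ℕ) : (t - n • t').1 ^ p ^ s = (t - n • t').1 := by
  rw [Prod.fst_sub, Prod.smul_fst, nsmul_eq_mul, sub_pow_char_pow, mul_pow, natCast_pow_char_pow, ht, ht']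

theorem card_offDiag_mul_of_pairs {α : Type} [Fintype α] [DecidableEq α] (𝒮 : Finset (Finset α))
    {i N : ℕ} (hi : ∀ S ∈ 𝒮, S.card = i)
    (hN : ∀ x y, x ≠ y → (𝒮.filter fun S => x ∈ S ∧ y ∈ S).card = N) :
    (Fintype.card α * Fintype.card α - Fintype.card α) * N = 𝒮.card * (i * i - i) := by
  have h := Finset.sum_card_bipartiteAbove_eq_sum_card_bipartiteBelow
    (s := (Finset.univ : Finset α).offDiag) (t := 𝒮) (fun z S => z.1 ∈ S ∧ z.2 ∈ S)
  rw [Finset.sum_const_nat (m := N), Finset.sum_const_nat (m := i * i - i),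
    Finset.offDiag_card, Finset.card_univ] at h
  · exact h
  · intro S hS
    rw [← hi S hS, ← Finset.offDiag_card]
    congr 1
    ext z
    simp only [Finset.bipartiteBelow, Finset.mem_filter, Finset.mem_offDiag, Finset.mem_univ,
      true_and]
    tauto
  · intro z hz
    exact hN _ _ (Finset.mem_offDiag.1 hz).2.2

theorem sum_card_zeros_sub {t t' : F × F × F × ZMod p} (h : zeros p s l t = zeros p s l t') :
    ∑ n ∈ (Finset.univ : Finset (ZMod p)).erase 0, ((zeros p s l (t - n.val • t')).card : ℤ)
      = Fintype.card F + (p - 2) * (zeros p s l t).card := by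
  have hp : ((Finset.univ : Finset (ZMod p)).erase 0).card = p - 1 := by
    rw [Finset.card_erase_of_mem (Finset.mem_univ _), Finset.card_univ, ZMod.card]
  have hx : ∀ x : F, (∑ n ∈ (Finset.univ : Finset (ZMod p)).erase 0,
      if coord p s l x (t - n.val • t') = 0 then (1 : ℤ) else 0)
      = if coord p s l x t = 0 then ((p : ℤ) - 2) + 1 else 0 + 1 := by
    intro x
    simp only [map_sub, coord_val_nsmul]
    have hiff : coord p s l x t = 0 ↔ coord p s l x t' = 0 := by
      rw [← mem_zeros, h, mem_zeros]
    split_ifs with h0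
    · simp only [h0, hiff.1 h0, mul_zero, sub_zero, if_true, Finset.sum_const, hp]
      rw [nsmul_eq_mul, Nat.cast_sub (Fact.out : p.Prime).one_le]
      push_cast
      ring
    · have h0' := mt hiff.2 h0
      rw [Finset.sum_eq_single (coord p s l x t / coord p s l x t')]
      · rw [div_mul_cancel₀ _ h0', sub_self, if_pos rfl, zero_add]
      · intro n _ hn
        refine if_neg fun hc => hn ?_
        rw [eq_div_iff h0']
        exact (sub_eq_zero.1 hc).symm
      · intro hc
        exact absurd (Finset.mem_erase.2 ⟨div_ne_zero h0 h0', Finset.mem_univ _⟩) hc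
  have hz : ∀ t : F × F × F × ZMod p,
      ((zeros p s l t).card : ℤ) = ∑ x, if coord p s l x t = 0 then (1 : ℤ) else 0 := by
    intro t
    rw [zeros, Finset.card_filter]
    push_cast
    rfl
  simp only [hz]
  rw [Finset.sum_comm, Finset.sum_congr rfl fun x _ => hx x, Finset.mul_sum]
  rw [← Finset.card_univ, Finset.card_eq_sum_ones]
  push_cast
  rw [← Finset.sum_add_distrib]
  refine Finset.sum_congr rfl fun x _ => ?_
  split_ifs <;> ring

namespace KasamiParams

theorem exists_nsmul_of_zeros_eq (H : KasamiParams p s l d F) {t t' : F × F × F × ZMod p}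
    (ht : t ∈ weightSet p s l d F) (ht' : t' ∈ weightSet p s l d F)
    (h : zeros p s l t = zeros p s l t') : ∃ n : ZMod p, n ≠ 0 ∧ n.val • t' = t := by
  by_contra! hc
  rw [mem_weightSet] at ht ht'
  have hle : ∀ n ∈ (Finset.univ : Finset (ZMod p)).erase 0,
      (p : ℤ) * (zeros p s l (t - n.val • t')).card ≤ Fintype.card F + p ^ s * (p ^ d) ^ 2 :=
    fun n hn => H.card_zeros_le (fst_sub_nsmul ht.1 ht'.1 _)
      (sub_ne_zero.2 (hc n (Finset.ne_of_mem_erase hn)).symm)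
  have hsum := Finset.sum_le_sum hle
  have h1 : (3 : ℤ) ≤ p := by exact_mod_cast H.three_le
  rw [← Finset.mul_sum, sum_card_zeros_sub h, Finset.sum_const,
    Finset.card_erase_of_mem (Finset.mem_univ _), Finset.card_univ, ZMod.card, nsmul_eq_mul,
    Nat.cast_sub (Fact.out : p.Prime).one_le, Nat.cast_one] at hsum
  have h3 : (0 : ℤ) < p ^ s := by positivity
  have h4 : (0 : ℤ) < p ^ s * (p ^ d) ^ 2 := by positivity
  have h6 : (p : ℤ) * (p ^ d) ^ 2 ≤ p ^ s := by exact_mod_cast H.mul_sq_le_pow_s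
  have hq := H.card_eq_sq
  have e := ht.2
  have h7 : ((p : ℤ) - 1) * Fintype.card F ≤ (p - 1) * ((p - 1) * (p ^ s * (p ^ d) ^ 2)) := by
    have : (p : ℤ) * (Fintype.card F + (p - 2) * (zeros p s l t).card)
        = p * Fintype.card F + (p - 2) * (Fintype.card F - (p - 1) * (p ^ s * (p ^ d) ^ 2)) := by
      rw [← e]; ring
    rw [this] at hsum
    linarith
  have h8 := le_of_mul_le_mul_left h7 (by linarith)
  rw [hq] at h8
  nlinarith

theorem exists_coord_ne_zero (H : KasamiParams p s l d F) {t : F × F × F × ZMod p}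
    (ht : t ∈ weightSet p s l d F) : ∃ x, coord p s l x t ≠ 0 := by
  by_contra! hc
  have h : zeros p s l t = Finset.univ := by ext x; simp [mem_zeros, hc]
  have e := (mem_weightSet.1 ht).2
  have h1 : (3 : ℤ) ≤ p := by exact_mod_cast H.three_le
  have h4 : (0 : ℤ) < p ^ s * (p ^ d) ^ 2 := by positivity
  have hq : (0 : ℤ) < Fintype.card F := by exact_mod_cast Fintype.card_pos
  rw [h, Finset.card_univ] at e
  nlinarith

theorem card_weightSet_fiber (H : KasamiParams p s l d F) {t : F × F × F × ZMod p}
    (ht : t ∈ weightSet p s l d F) :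
    ((weightSet p s l d F).filter fun t' => (zeros p s l t')ᶜ = (zeros p s l t)ᶜ).card
      = p - 1 := by
  have hp : ((Finset.univ : Finset (ZMod p)).erase 0).card = p - 1 := by
    rw [Finset.card_erase_of_mem (Finset.mem_univ _), Finset.card_univ, ZMod.card]
  rw [← hp]
  symm
  refine Finset.card_bij (fun n _ => n.val • t) ?_ ?_ ?_
  · intro n hn
    have hn0 := Finset.ne_of_mem_erase hn
    have hz : zeros p s l (n.val • t) = zeros p s l t := by
      ext x
      rw [mem_zeros, mem_zeros, coord_val_nsmul, mul_eq_zero, or_iff_right hn0]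
    rw [Finset.mem_filter, mem_weightSet, hz]
    obtain ⟨h1, h2⟩ := mem_weightSet.1 ht
    refine ⟨⟨?_, h2⟩, rfl⟩
    rw [Prod.smul_fst, nsmul_eq_mul, mul_pow, natCast_pow_char_pow, h1]
  · intro n _ n' _ hnn
    obtain ⟨x, hx⟩ := H.exists_coord_ne_zero ht
    have := congrArg (coord p s l x) hnn
    simp only [coord_val_nsmul] at this
    exact mul_right_cancel₀ hx this
  · intro t' ht'
    obtain ⟨h1, h2⟩ := Finset.mem_filter.1 ht'
    obtain ⟨n, hn, h⟩ := H.exists_nsmul_of_zeros_eq h1 ht (compl_injective h2)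
    exact ⟨n, Finset.mem_erase.2 ⟨hn, Finset.mem_univ _⟩, h⟩

theorem card_weightSet_eq (H : KasamiParams p s l d F) :
    (weightSet p s l d F).card = (blocks p s l d F).card * (p - 1) := by
  rw [Finset.card_eq_sum_card_image (fun t => (zeros p s l t)ᶜ), blocks,
    Finset.sum_const_nat (m := p - 1)]
  intro S hS
  obtain ⟨t, ht, rfl⟩ := Finset.mem_image.1 hS
  exact H.card_weightSet_fiber ht

theorem card_weightSet_mul (H : KasamiParams p s l d F) :
    (weightSet p s l d F).card * (p ^ d) ^ 4 = (minParams p s l d F).card * Fintype.card F := by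
  have hmaps : ∀ z ∈ minParams p s l d F ×ˢ (Finset.univ : Finset F),
      ((z.1.1, z.1.2, adj p s l z.1.1 z.1.2 z.2, qf p s l z.1.1 z.1.2 z.2) : F × F × F × ZMod p)
        ∈ weightSet p s l d F := by
    intro z hz
    have hm := (Finset.mem_product.1 hz).1
    have ha : z.1.1 ^ p ^ s = z.1.1 := by
      have := Finset.mem_of_mem_erase (Finset.mem_filter.1 hm).1
      simpa [formParams] using this
    rw [mem_weightSet]
    exact ⟨ha, (H.card_zeros_eq_iff ha).2 ⟨hm, z.2, rfl, rfl⟩⟩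
  rw [← Finset.card_univ, ← Finset.card_product, Finset.card_eq_sum_card_fiberwise hmaps,
    Finset.sum_const_nat (m := (p ^ d) ^ 4)]
  rintro ⟨a, b, c, h⟩ ht
  obtain ⟨ha, hz⟩ := mem_weightSet.1 ht
  obtain ⟨hm, x0, hx0, hx0'⟩ := (H.card_zeros_eq_iff ha).1 hz
  simp only at ha hm hx0 hx0'
  obtain ⟨hm1, hS⟩ := Finset.mem_filter.1 hm
  have hab : a ≠ 0 ∨ b ≠ 0 := by
    by_contra! hc
    exact (Finset.mem_erase.1 hm1).1 (Prod.ext hc.1 hc.2)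
  have hrad : (Finset.univ.filter fun x => adj p s l a b x = 0).card = (p ^ d) ^ 4 := by
    have h1 : (3 : ℤ) ≤ p := by exact_mod_cast H.three_le
    have h3 : (0 : ℤ) < p ^ s := by positivity
    have h5 : (0 : ℤ) < p ^ s * p ^ d := by positivity
    have h4 : (0 : ℤ) < p ^ s * (p ^ d) ^ 2 := by positivity
    have h2 : (p : ℤ) ≤ p ^ d := by exact_mod_cast H.le_pow_d
    have h6 : (1 : ℤ) < (p ^ d) ^ 2 := by nlinarith
    simp only at hS
    rcases H.expSum_values ha hab with hv | hv | hv
    · have := hv.1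
      rw [hS] at this
      nlinarith
    · have := hv.1
      rw [hS] at this
      linarith
    · exact hv.2
  rw [← hrad]
  symm
  refine Finset.card_bij (fun z _ => ((a, b), x0 + z)) ?_ ?_ ?_
  · intro z hz
    have hz := (Finset.mem_filter.1 hz).2
    refine Finset.mem_filter.2 ⟨Finset.mem_product.2 ⟨hm, Finset.mem_univ _⟩, ?_⟩
    simp only [map_add, H.qf_add ha, hz, H.qf_eq_zero_of_adj ha hz, hx0, hx0', zero_mul, map_zero,
      add_zero]
  · intro z _ z' _ hzz
    simpa using hzz
  · rintro ⟨⟨a', b'⟩, x⟩ hx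
    obtain ⟨-, hx⟩ := Finset.mem_filter.1 hx
    simp only [Prod.mk.injEq] at hx
    obtain ⟨rfl, rfl, hx, -⟩ := hx
    refine ⟨x - x0, ?_, by simp⟩
    simp [hx, hx0]

theorem exists_affine (H : KasamiParams p s l d F) {t : F × F × F × ZMod p}
    (ht : t ∈ weightSet p s l d F) {u : F} (hu : u ≠ 0) (v : F) :
    ∃ t' ∈ weightSet p s l d F, ∀ x, x ∈ zeros p s l t' ↔ u * x + v ∈ zeros p s l t := by
  obtain ⟨a, b, c, h⟩ := t
  obtain ⟨ha, hz⟩ := mem_weightSet.1 ht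
  simp only at ha
  let t' : F × F × F × ZMod p := (a * u ^ (p ^ s + 1), b * u ^ (p ^ l + 1),
    adj p s l a b v * u + c * u, qf p s l a b v + absTr p (c * v) + h)
  have hx : ∀ x, x ∈ zeros p s l t' ↔ u * x + v ∈ zeros p s l (a, b, c, h) := by
    intro x
    have e : qf p s l (a * u ^ (p ^ s + 1)) (b * u ^ (p ^ l + 1)) x = qf p s l a b (u * x) := by
      simp only [qf]
      congr 1
      ring
    have e2 : absTr p ((adj p s l a b v * u + c * u) * x)
        = absTr p (adj p s l a b v * (u * x)) + absTr p (c * (u * x)) := by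
      rw [← map_add]
      congr 1
      ring
    rw [mem_zeros, mem_zeros, coord_apply, coord_apply, H.qf_add ha]
    simp only [t', e, e2, mul_add, map_add]
    constructor <;> intro h <;> linear_combination h
  refine ⟨t', mem_weightSet.2 ⟨?_, ?_⟩, hx⟩
  · simp only [t']
    rw [mul_pow, ha, pow_succ u, mul_pow, pow_pow_iterate, ← two_mul, pow_card_self H.card,
      mul_comm u]
  · rw [← hz]
    congr 2
    refine Finset.card_bij (fun x _ => u * x + v) (fun x h => (hx x).1 h) ?_ ?_
    · intro x _ y _ hxy
      exact mul_left_cancel₀ hu (add_right_cancel hxy)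
    · intro y hy
      have e : u * ((y - v) / u) + v = y := by field_simp; ring
      exact ⟨(y - v) / u, (hx _).2 (by rwa [e]), e⟩

theorem card_pairs_le (H : KasamiParams p s l d F) {x y x' y' : F} (hxy : x ≠ y)
    (hxy' : x' ≠ y') :
    ((blocks p s l d F).filter fun S => x ∈ S ∧ y ∈ S).card
      ≤ ((blocks p s l d F).filter fun S => x' ∈ S ∧ y' ∈ S).card := by
  have h' : y' - x' ≠ 0 := sub_ne_zero.2 hxy'.symm
  set u := (y - x) / (y' - x') with hu_def
  have hu : u ≠ 0 := div_ne_zero (sub_ne_zero.2 hxy.symm) h'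
  set v := x - u * x' with hv
  have ex : u * x' + v = x := by rw [hv]; ring
  have ey : u * y' + v = y := by rw [hv, hu_def]; field_simp; ring
  refine Finset.card_le_card_of_injOn (fun S => Finset.univ.filter fun z => u * z + v ∈ S) ?_ ?_
  · intro S hS
    obtain ⟨hS, hxS, hyS⟩ := Finset.mem_filter.1 hS
    obtain ⟨t, ht, rfl⟩ := Finset.mem_image.1 hS
    obtain ⟨t', ht', h⟩ := H.exists_affine ht hu v
    refine Finset.mem_filter.2 ⟨Finset.mem_image.2 ⟨t', ht', ?_⟩, ?_, ?_⟩
    · ext z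
      simp [h]
    · exact Finset.mem_filter.2 ⟨Finset.mem_univ _, ex.symm ▸ hxS⟩
    · exact Finset.mem_filter.2 ⟨Finset.mem_univ _, ey.symm ▸ hyS⟩
  · intro S _ S' _ hSS
    ext z
    have e : u * ((z - v) / u) + v = z := by field_simp; ring
    have := Finset.ext_iff.1 hSS ((z - v) / u)
    simpa [e] using this

end KasamiParams

end Design

theorem KasamiParams.of_gcd {p s l d : ℕ} {F : Type} [Fintype F] (hodd : Odd p)
    (hs : 2 ≤ s) (hls : l ≠ s) (hl1 : 1 ≤ l) (hl2 : l ≤ 2 * s - 1)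
    (hF : Fintype.card F = p ^ (2 * s))
    (hd : Nat.gcd s l = d) (hd' : Nat.gcd (s + l) (2 * l) = 2 * d) :
    KasamiParams p s l d F := by
  have hd0 : 0 < d := by
    rw [← hd]
    exact Nat.gcd_pos_of_pos_left l (by omega)
  obtain ⟨s', hs'⟩ : d ∣ s := hd ▸ Nat.gcd_dvd_left s l
  obtain ⟨l', hl'⟩ : d ∣ l := hd ▸ Nat.gcd_dvd_right s l
  have hcop : Nat.gcd s' l' = 1 := by
    rw [hs', hl', Nat.gcd_mul_left] at hd
    exact Nat.eq_of_mul_eq_mul_left hd0 (by rw [hd, mul_one])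
  have hsum : 2 ∣ s' + l' := by
    have h : 2 * d ∣ s + l := hd' ▸ Nat.gcd_dvd_left _ _
    rw [hs', hl', ← mul_add, mul_comm 2 d] at h
    exact Nat.dvd_of_mul_dvd_mul_left hd0 h
  have hpar : s' % 2 = 1 ∧ l' % 2 = 1 := by
    by_contra hc
    have h1 : 2 ∣ s' := by omega
    have h2 : 2 ∣ l' := by omega
    have := Nat.dvd_gcd h1 h2
    omega
  have hs1 : s' ≠ 1 := by
    rintro rfl
    have hl1' : l' ≠ 1 := by
      rintro rfl
      exact hls (by rw [hs', hl'])
    have h3 : 3 ≤ l' := by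
      have := hpar.2
      omega
    have : d * 3 ≤ d * l' := Nat.mul_le_mul_left d h3
    omega
  refine ⟨hodd, hF, hd0, ⟨s' / 2, by omega, ?_⟩, ⟨l' / 2, ?_⟩, ?_, by omega⟩
  · rw [hs']
    congr 1
    omega
  · rw [hl']
    congr 1
    omega
  · rw [← hd']
    refine Nat.dvd_antisymm (Nat.dvd_gcd (Nat.gcd_dvd_left _ _) ?_)
      (Nat.dvd_gcd (Nat.gcd_dvd_left _ _) ?_)
    · have h1 := (Nat.gcd_dvd_left (s + l) (2 * s)).mul_left 2
      rw [mul_add] at h1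
      exact (Nat.dvd_add_right (Nat.gcd_dvd_right _ _)).1 h1
    · have h1 := (Nat.gcd_dvd_left (s + l) (2 * l)).mul_left 2
      rw [mul_add] at h1
      exact (Nat.dvd_add_left (Nat.gcd_dvd_right _ _)).1 h1

theorem design_arith {p P D R W n B N : ℚ} (hp : 3 ≤ p) (hD : 1 < D) (hP : 1 < P)
    (hW : W = B * (p - 1)) (hM : W * D ^ 4 = n * P ^ 2)
    (hn : n * (D ^ 2 - 1) * D * (D + 1) = (P ^ 2 - 1) * (D * (D * p * R - 1)))
    (hN : (P ^ 2 * P ^ 2 - P ^ 2) * N =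
      B * (D ^ 4 * ((p - 1) * (R * (p * R + 1))) * (D ^ 4 * ((p - 1) * (R * (p * R + 1))))
        - D ^ 4 * ((p - 1) * (R * (p * R + 1))))) :
    N = R * (D * p * R - 1) * (p * R + 1) * (D ^ 4 * ((p - 1) * (R * (p * R + 1))) - 1)
      / ((D + 1) * (D ^ 2 - 1)) := by
  have hD1 : 0 < D + 1 := by linarith
  have hD2 : 0 < D ^ 2 - 1 := sub_pos.2 (one_lt_pow₀ hD two_ne_zero)
  have hpn : p - 1 ≠ 0 := by linarith
  have hPne : P ^ 2 * P ^ 2 - P ^ 2 ≠ 0 := by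
    have h1 : 0 < P ^ 2 - 1 := sub_pos.2 (one_lt_pow₀ hP two_ne_zero)
    have h2 : P ^ 2 * P ^ 2 - P ^ 2 = P ^ 2 * (P ^ 2 - 1) := by ring
    rw [h2]
    exact mul_ne_zero (pow_ne_zero 2 (by linarith)) h1.ne'
  rw [eq_div_iff (mul_pos hD1 hD2).ne']
  have hne : (P ^ 2 * P ^ 2 - P ^ 2) * ((p - 1) * D ^ 5) ≠ 0 :=
    mul_ne_zero hPne (mul_ne_zero hpn (pow_ne_zero 5 (by linarith)))
  apply mul_left_cancel₀ hne
  obtain ⟨I, hI⟩ : ∃ I, I = D ^ 4 * ((p - 1) * (R * (p * R + 1))) := ⟨_, rfl⟩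
  rw [← hI] at hN ⊢
  calc _ = (I * I - I) * (P ^ 2 * P ^ 2 - P ^ 2) * (D * (D * p * R - 1)) := by
        linear_combination ((p - 1) * D ^ 5 * (D + 1) * (D ^ 2 - 1)) * hN
          - (I * I - I) * D ^ 5 * (D + 1) * (D ^ 2 - 1) * hW
          + (I * I - I) * D * (D + 1) * (D ^ 2 - 1) * hM + (I * I - I) * P ^ 2 * hn
    _ = _ := by
        linear_combination (I - 1) * (P ^ 2 * P ^ 2 - P ^ 2) * (D * (D * p * R - 1)) * hI

section Main

variable {p s l d : ℕ} [Fact p.Prime] {F : Type} [Field F] [CharP F p] [Fintype F] [DecidableEq F]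

theorem KasamiParams.exists_s_eq (H : KasamiParams p s l d F) : ∃ r, s = 2 * d + 1 + r := by
  obtain ⟨k, hk, h⟩ := H.s_eq
  have := H.d_pos
  refine ⟨s - (2 * d + 1), ?_⟩
  have : d * 3 ≤ d * (2 * k + 1) := Nat.mul_le_mul_left d (by omega)
  omega

theorem KasamiParams.card_compl_zeros_iff (H : KasamiParams p s l d F)
    (t : F × F × F × ZMod p) :
    ((zeros p s l t)ᶜ).card = p ^ (s + 2 * d - 1) * (p - 1) * (p ^ (s - 2 * d) + 1) ↔
      (p : ℤ) * (zeros p s l t).card = Fintype.card F - (p - 1) * (p ^ s * (p ^ d) ^ 2) := by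
  obtain ⟨r, hr⟩ := H.exists_s_eq
  have hq := H.card_eq_sq
  have h1 : (3 : ℤ) ≤ p := by exact_mod_cast H.three_le
  have hc : ((zeros p s l t).card : ℤ) + ((zeros p s l t)ᶜ).card = Fintype.card F := by
    exact_mod_cast Finset.card_add_card_compl _
  have e1 : s + 2 * d - 1 = 4 * d + r := by omega
  have e2 : s - 2 * d = r + 1 := by omega
  have hi : (p : ℤ) * (p ^ (4 * d + r) * (p - 1) * (p ^ (r + 1) + 1))
      = (p - 1) * (((p : ℤ) ^ s) ^ 2 + p ^ s * (p ^ d) ^ 2) := by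
    rw [hr]; ring
  rw [e1, e2, ← Nat.cast_inj (R := ℤ)]
  push_cast [Nat.cast_sub (Fact.out : p.Prime).one_le]
  constructor
  · intro h
    rw [← h, ← hq] at hi
    linear_combination (p : ℤ) * hc - hi
  · intro h
    apply mul_left_cancel₀ (show (p : ℤ) ≠ 0 by linarith)
    rw [hi, ← hq]
    linear_combination (p : ℤ) * hc - h

theorem KasamiParams.filter_eq_weightSet (H : KasamiParams p s l d F) :
    ((Finset.univ : Finset (F × F × F × ZMod p)).filter fun t =>
        t.1 ^ p ^ s = t.1 ∧ (suppw p s l t.1 t.2.1 t.2.2.1 t.2.2.2).card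
            = p ^ (s + 2 * d - 1) * (p - 1) * (p ^ (s - 2 * d) + 1)) = weightSet p s l d F := by
  refine Finset.filter_congr fun t _ => and_congr_right fun ht => ?_
  rw [H.suppw_eq_compl ht, H.card_compl_zeros_iff]

theorem KasamiParams.image_eq_blocks (H : KasamiParams p s l d F) :
    (((Finset.univ : Finset (F × F × F × ZMod p)).filter fun t =>
        t.1 ^ p ^ s = t.1 ∧ (suppw p s l t.1 t.2.1 t.2.2.1 t.2.2.2).card
            = p ^ (s + 2 * d - 1) * (p - 1) * (p ^ (s - 2 * d) + 1)).image
        fun t => suppw p s l t.1 t.2.1 t.2.2.1 t.2.2.2) = blocks p s l d F := by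
  rw [H.filter_eq_weightSet, blocks]
  exact Finset.image_congr fun t ht => H.suppw_eq_compl (mem_weightSet.1 ht).1

theorem KasamiParams.card_of_mem_blocks (H : KasamiParams p s l d F) {S : Finset F}
    (hS : S ∈ blocks p s l d F) :
    S.card = p ^ (s + 2 * d - 1) * (p - 1) * (p ^ (s - 2 * d) + 1) := by
  obtain ⟨t, ht, rfl⟩ := Finset.mem_image.1 hS
  exact (H.card_compl_zeros_iff t).2 (mem_weightSet.1 ht).2

theorem KasamiParams.card_pairs (H : KasamiParams p s l d F) {x y : F} (hxy : x ≠ y) :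
    (((blocks p s l d F).filter fun S => x ∈ S ∧ y ∈ S).card : ℚ)
      = (p : ℚ) ^ (s - 2 * d - 1) * ((p : ℚ) ^ (s - d) - 1) * ((p : ℚ) ^ (s - 2 * d) + 1)
          * ((p : ℚ) ^ (s + 2 * d - 1) * ((p : ℚ) - 1) * ((p : ℚ) ^ (s - 2 * d) + 1) - 1)
          / (((p : ℚ) ^ d + 1) * ((p : ℚ) ^ (2 * d) - 1)) := by
  have hcount := card_offDiag_mul_of_pairs (blocks p s l d F)
    (fun S hS => H.card_of_mem_blocks hS) (fun x' y' hxy' => le_antisymm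
      (H.card_pairs_le hxy' hxy) (H.card_pairs_le hxy hxy'))
  set N := ((blocks p s l d F).filter fun S => x ∈ S ∧ y ∈ S).card
  obtain ⟨r, hr⟩ := H.exists_s_eq
  have hW := congrArg (Nat.cast (R := ℚ)) H.card_weightSet_eq
  have hM := congrArg (Nat.cast (R := ℚ)) H.card_weightSet_mul
  have hn := congrArg (Int.cast (R := ℚ)) H.card_minParams
  have hN := congrArg (Nat.cast (R := ℚ)) hcount
  have e1 : s + 2 * d - 1 = 4 * d + r := by omega
  have e2 : s - 2 * d = r + 1 := by omega
  have e3 : s - 2 * d - 1 = r := by omega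
  have e4 : s - d = d + 1 + r := by omega
  have hq : (Fintype.card F : ℚ) = ((p : ℚ) ^ s) ^ 2 := by exact_mod_cast H.card_eq_sq
  have h3 : (3 : ℚ) ≤ p := by exact_mod_cast H.three_le
  have hp1 := (Fact.out : p.Prime).one_le
  have hD : (p : ℚ) ≤ (p : ℚ) ^ d := by exact_mod_cast H.le_pow_d
  rw [Nat.cast_mul, Nat.cast_mul, Nat.cast_sub (Nat.le_mul_self _), Nat.cast_sub (Nat.le_mul_self _)]
    at hN
  rw [e1, e2] at hN
  rw [e3, e1, e2, e4]
  push_cast [Nat.cast_sub hp1] at hW hM hn hN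
  rw [hq] at hM hN
  have hP : (p : ℚ) ^ s = (p ^ d) ^ 2 * p * p ^ r := by rw [hr]; ring
  have hs1 : (1 : ℚ) < (p : ℚ) ^ s := by
    have : p ≤ p ^ s := Nat.le_self_pow (by omega) p
    have : (p : ℚ) ≤ (p : ℚ) ^ s := by exact_mod_cast this
    linarith
  have hi : (p : ℚ) ^ (4 * d + r) * (p - 1) * (p ^ (r + 1) + 1)
      = (p ^ d) ^ 4 * ((p - 1) * (p ^ r * (p * p ^ r + 1))) := by ring
  have hr1 : (p : ℚ) ^ (r + 1) = p * p ^ r := by ring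
  have hdr : (p : ℚ) ^ (d + 1 + r) = p ^ d * p * p ^ r := by ring
  have hd2 : (p : ℚ) ^ (2 * d) = (p ^ d) ^ 2 := by ring
  rw [hi] at hN ⊢
  rw [hr1, hdr, hd2]
  have hDP : (p : ℚ) ^ s - p ^ d = p ^ d * (p ^ d * p * p ^ r - 1) := by rw [hP]; ring
  rw [hDP] at hn
  generalize (p : ℚ) ^ s = P at *
  generalize (p : ℚ) ^ d = D at *
  generalize (p : ℚ) ^ r = R at *
  generalize ((weightSet p s l d F).card : ℚ) = W at *
  generalize ((minParams p s l d F).card : ℚ) = n at *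
  generalize ((blocks p s l d F).card : ℚ) = B at *
  exact design_arith h3 (by linarith) hs1 hW hM hn hN

end Main

theorem stmt18 (p s l : ℕ) [Fact p.Prime] (F : Type) [Field F] [Fintype F] [DecidableEq F]
    [CharP F p] (hodd : Odd p) (hs : 2 ≤ s) (hl1 : 1 ≤ l) (hls : l ≠ s)
    (hl2 : l ≤ 2 * s - 1) (hF : Fintype.card F = p ^ (2 * s)) (d : ℕ)
    (hd : Nat.gcd s l = d) (hd' : Nat.gcd (s + l) (2 * l) = 2 * d) :
    (∀ S ∈ (((Finset.univ : Finset (F × F × F × ZMod p)).filter fun t =>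
        t.1 ^ p ^ s = t.1 ∧ (suppw p s l t.1 t.2.1 t.2.2.1 t.2.2.2).card
            = p ^ (s + 2 * d - 1) * (p - 1) * (p ^ (s - 2 * d) + 1)).image
        fun t => suppw p s l t.1 t.2.1 t.2.2.1 t.2.2.2),
      S.card = p ^ (s + 2 * d - 1) * (p - 1) * (p ^ (s - 2 * d) + 1)) ∧
    ∀ x y : F, x ≠ y →
      (((((Finset.univ : Finset (F × F × F × ZMod p)).filter fun t =>
        t.1 ^ p ^ s = t.1 ∧ (suppw p s l t.1 t.2.1 t.2.2.1 t.2.2.2).card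
            = p ^ (s + 2 * d - 1) * (p - 1) * (p ^ (s - 2 * d) + 1)).image
        fun t => suppw p s l t.1 t.2.1 t.2.2.1 t.2.2.2).filter
        fun S => x ∈ S ∧ y ∈ S).card : ℚ)
        = (p : ℚ) ^ (s - 2 * d - 1) * ((p : ℚ) ^ (s - d) - 1) * ((p : ℚ) ^ (s - 2 * d) + 1)
          * ((p : ℚ) ^ (s + 2 * d - 1) * ((p : ℚ) - 1) * ((p : ℚ) ^ (s - 2 * d) + 1) - 1)
          / (((p : ℚ) ^ d + 1) * ((p : ℚ) ^ (2 * d) - 1)) := by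
  have H : KasamiParams p s l d F := .of_gcd hodd hs hls hl1 hl2 hF hd hd'
  rw [H.image_eq_blocks]
  exact ⟨fun S hS => H.card_of_mem_blocks hS, fun x y hxy => H.card_pairs hxy⟩
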